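/- arXiv:math/0202215 — 7 statements merged into one kernel-verified Lean document; each statement's English description precedes it below -/
import Mathlib

section
/- Let α = r·π with r irrational, and let φ₁(z) = (1/3)·exp(√−1·α)·z − 1 and φ₂(z) = (1/3)·exp(√−1·α)·z + 1. Let K ⊆ ℂ be the attractor of (φ₁, φ₂) and K̃ = convexHull ℝ K. Then the set of extreme points of K̃ (equivalently, the set of sides of K̃) is infinite. -/
open Set

/-- Every point of a self-similar set `K = (c K - 1) ∪ (c K + 1)` has a partner in `K` differing
from it by `± 2 c ^ n`: flip the `n`-th digit of its expansion. -/
lemma exists_mem_sub_eq_two_mul_pow {K : Set ℂ} {c : ℂ}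
    (hK : K = (fun z => c * z - 1) '' K ∪ (fun z => c * z + 1) '' K) (n : ℕ) :
    ∀ z ∈ K, ∃ w ∈ K, w - z = 2 * c ^ n ∨ w - z = -(2 * c ^ n) := by
  have hsub : ∀ z ∈ K, c * z - 1 ∈ K := fun z hz => by
    rw [hK]; exact Or.inl ⟨z, hz, rfl⟩
  have hadd : ∀ z ∈ K, c * z + 1 ∈ K := fun z hz => by
    rw [hK]; exact Or.inr ⟨z, hz, rfl⟩
  induction n with
  | zero =>
    intro z hz
    rw [hK] at hz
    rcases hz with ⟨y, hy, rfl⟩ | ⟨y, hy, rfl⟩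
    · exact ⟨_, hadd y hy, Or.inl (by ring)⟩
    · exact ⟨_, hsub y hy, Or.inr (by ring)⟩
  | succ n ih =>
    intro z hz
    rw [hK] at hz
    rcases hz with ⟨y, hy, rfl⟩ | ⟨y, hy, rfl⟩ <;> obtain ⟨w, hw, h⟩ := ih y hy
    · exact ⟨_, hsub w hw, h.imp (fun h => by linear_combination c * h)
        (fun h => by linear_combination c * h)⟩
    · exact ⟨_, hadd w hw, h.imp (fun h => by linear_combination c * h)
        (fun h => by linear_combination c * h)⟩

/-- In a finite-dimensional space, the convex hull of a compact set is compact. -/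
lemma isCompact_convexHull_of_finiteDimensional {E : Type*} [NormedAddCommGroup E]
    [NormedSpace ℝ E] [FiniteDimensional ℝ E] {K : Set E} (hKc : IsCompact K) :
    IsCompact (convexHull ℝ K) := by
  have hEq : convexHull ℝ K = ⋃ k ∈ Set.Iic (Module.finrank ℝ E + 1),
      (fun p : (Fin k → ℝ) × (Fin k → E) => ∑ i, p.1 i • p.2 i) ''
        (stdSimplex ℝ (Fin k) ×ˢ Set.univ.pi fun _ => K) := by
    apply Set.Subset.antisymm
    · intro x hx
      obtain ⟨ι, _, z, w, hz, hind, hw, hw1, rfl⟩ := eq_pos_convex_span_of_mem_convexHull hx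
      have hcard : Fintype.card ι ≤ Module.finrank ℝ E + 1 :=
        hind.card_le_finrank_succ.trans (Nat.succ_le_succ (Submodule.finrank_le _))
      let e := Fintype.equivFin ι
      refine Set.mem_biUnion hcard ⟨(w ∘ e.symm, z ∘ e.symm), ⟨⟨fun i => (hw _).le, ?_⟩,
        fun i _ => hz ⟨_, rfl⟩⟩, ?_⟩
      · rw [← hw1]
        exact e.symm.sum_comp w
      · exact e.symm.sum_comp fun i => w i • z i
    · refine Set.iUnion₂_subset fun k _ => ?_
      rintro _ ⟨⟨w, z⟩, ⟨⟨hw, hw1⟩, hz⟩, rfl⟩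
      exact (convex_convexHull ℝ K).sum_mem (fun i _ => hw i) hw1
        fun i _ => subset_convexHull ℝ K (hz i trivial)
  rw [hEq]
  refine (Set.finite_Iic _).isCompact_biUnion fun k _ => ?_
  exact ((isCompact_stdSimplex ℝ _).prod (isCompact_univ_pi fun _ => hKc)).image (by fun_prop)

/-- If a continuous linear functional attains its maximum over a compact set at two distinct
points, then two distinct extreme points of the convex hull take the same value. -/
lemma exists_ne_extremePoints_of_isMaxOn {E : Type*} [NormedAddCommGroup E] [NormedSpace ℝ E]
    [FiniteDimensional ℝ E] {K : Set E} (hKc : IsCompact K) (l : E →L[ℝ] ℝ) {z w : E}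
    (hz : z ∈ K) (hw : w ∈ K) (hzw : z ≠ w) (hmax : IsMaxOn l K z) (hlw : l w = l z) :
    ∃ p ∈ extremePoints ℝ (convexHull ℝ K), ∃ q ∈ extremePoints ℝ (convexHull ℝ K),
      p ≠ q ∧ l p = l q := by
  have hle : ∀ y ∈ convexHull ℝ K, l y ≤ l z :=
    convexHull_min (fun y hy => hmax hy) (convex_halfSpace_le l.isLinear _)
  have hC : IsCompact (convexHull ℝ K) := isCompact_convexHull_of_finiteDimensional hKc
  have hexp : IsExposed ℝ (convexHull ℝ K) (l.toExposed (convexHull ℝ K)) :=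
    ContinuousLinearMap.toExposed.isExposed
  have hzF : z ∈ l.toExposed (convexHull ℝ K) := ⟨subset_convexHull ℝ K hz, hle⟩
  have hwF : w ∈ l.toExposed (convexHull ℝ K) :=
    ⟨subset_convexHull ℝ K hw, fun y hy => hlw ▸ hle y hy⟩
  have hKM := closure_convexHull_extremePoints (hexp.isCompact hC)
    (hexp.convex (convex_convexHull ℝ K))
  have hnt : (extremePoints ℝ (l.toExposed (convexHull ℝ K))).Nontrivial := by
    by_contra h
    rw [Set.not_nontrivial_iff] at h
    rcases h.eq_empty_or_singleton with h | ⟨x, h⟩ <;> rw [h] at hKM <;>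
      rw [← hKM] at hzF hwF <;> simp at hzF hwF
    exact hzw (hzF.trans hwF.symm)
  obtain ⟨p, hp, q, hq, hpq⟩ := hnt
  exact ⟨p, hexp.isExtreme.extremePoints_subset_extremePoints hp,
    q, hexp.isExtreme.extremePoints_subset_extremePoints hq, hpq,
    le_antisymm (hq.1.2 p hp.1.1) (hp.1.2 q hq.1.1)⟩

/-- Two complex numbers which are real multiples of the same nonzero number are
real multiples of each other. -/
lemma im_mul_conj_eq_zero {d a b : ℂ} (hd : d ≠ 0) (ha : (d * starRingEnd ℂ a).im = 0)
    (hb : (d * starRingEnd ℂ b).im = 0) : (a * starRingEnd ℂ b).im = 0 := by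
  have hd' : Complex.normSq d ≠ 0 := by simpa using hd
  refine (mul_eq_zero.1 (?_ : Complex.normSq d * (a * starRingEnd ℂ b).im = 0)).resolve_left hd'
  simp only [Complex.mul_im, Complex.conj_re, Complex.conj_im, Complex.normSq_apply] at *
  linear_combination (d.re * b.re + d.im * b.im) * (-ha) + (d.re * a.re + d.im * a.im) * hb

/-- Distinct powers of `e^{iα}/3` are not real multiples of each other when `α / π` is
irrational. -/
lemma im_pow_mul_conj_pow_ne_zero {r : ℝ} (hr : Irrational r) {m n : ℕ} (hmn : m ≠ n) :
    (((1 / 3 : ℂ) * Complex.exp (Complex.I * ((r * Real.pi : ℝ) : ℂ))) ^ m *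
      starRingEnd ℂ (((1 / 3 : ℂ) * Complex.exp (Complex.I * ((r * Real.pi : ℝ) : ℂ))) ^ n)).im
        ≠ 0 := by
  have key : ((1 / 3 : ℂ) * Complex.exp (Complex.I * ((r * Real.pi : ℝ) : ℂ))) ^ m *
      starRingEnd ℂ (((1 / 3 : ℂ) * Complex.exp (Complex.I * ((r * Real.pi : ℝ) : ℂ))) ^ n)
      = (((1 / 3 : ℝ) ^ (m + n) : ℝ) : ℂ) *
        Complex.exp ((((m - n : ℝ) * (r * Real.pi) : ℝ) : ℂ) * Complex.I) := by
    have hexp : Complex.exp ((((m - n : ℝ) * (r * Real.pi) : ℝ) : ℂ) * Complex.I)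
        = Complex.exp (Complex.I * ((r * Real.pi : ℝ) : ℂ)) ^ m *
          Complex.exp (-Complex.I * ((r * Real.pi : ℝ) : ℂ)) ^ n := by
      rw [← Complex.exp_nat_mul, ← Complex.exp_nat_mul, ← Complex.exp_add]
      congr 1
      push_cast
      ring
    rw [hexp, map_pow, map_mul, ← Complex.exp_conj, map_mul, Complex.conj_I, Complex.conj_ofReal,
      map_div₀, map_one, map_ofNat]
    push_cast
    ring
  rw [key, Complex.im_ofReal_mul,
    Complex.exp_ofReal_mul_I_im]
  refine mul_ne_zero (by positivity) fun h => ?_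
  obtain ⟨k, hk⟩ := Real.sin_eq_zero_iff.1 h
  have hk' : (k : ℝ) = ((m : ℤ) - (n : ℤ) : ℤ) * r := by
    apply mul_right_cancel₀ Real.pi_ne_zero
    push_cast
    linear_combination hk
  have hirr : Irrational (((m : ℤ) - (n : ℤ) : ℤ) * r) :=
    hr.intCast_mul (by omega)
  exact hirr.ne_int k hk'.symm

/-- Example 1: for `φ₁ z = (1/3)e^{iα}z - 1`, `φ₂ z = (1/3)e^{iα}z + 1` with `α = rπ`,
`r` irrational, the convex hull of the attractor has infinitely many extreme points. -/
theorem example_infinite_extreme_points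
    (r : ℝ) (hr : Irrational r) (α : ℝ) (hα : α = r * Real.pi)
    (φ₁ φ₂ : ℂ → ℂ)
    (hφ₁ : ∀ z, φ₁ z = (1 / 3 : ℂ) * Complex.exp (Complex.I * (α : ℂ)) * z - 1)
    (hφ₂ : ∀ z, φ₂ z = (1 / 3 : ℂ) * Complex.exp (Complex.I * (α : ℂ)) * z + 1)
    (K : Set ℂ) (hKne : K.Nonempty) (hKc : IsCompact K)
    (hKinv : K = φ₁ '' K ∪ φ₂ '' K) :
    (extremePoints ℝ (convexHull ℝ K)).Infinite := by
  intro hfin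
  subst hα
  have hpow := fun m n : ℕ => im_pow_mul_conj_pow_ne_zero hr (m := m) (n := n)
  rw [funext hφ₁, funext hφ₂] at hKinv
  have hc : (1 / 3 : ℂ) * Complex.exp (Complex.I * ((r * Real.pi : ℝ) : ℂ)) ≠ 0 :=
    mul_ne_zero (by norm_num) (Complex.exp_ne_zero _)
  generalize (1 / 3 : ℂ) * Complex.exp (Complex.I * ((r * Real.pi : ℝ) : ℂ)) = c at *
  have hpair : ∀ n : ℕ, ∃ pq : extremePoints ℝ (convexHull ℝ K) ×
      extremePoints ℝ (convexHull ℝ K), (pq.1 : ℂ) - pq.2 ≠ 0 ∧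
        (((pq.1 : ℂ) - pq.2) * starRingEnd ℂ (c ^ n)).im = 0 := by
    intro n
    let l : ℂ →L[ℝ] ℝ :=
      Complex.imCLM.comp ((ContinuousLinearMap.mul ℝ ℂ).flip (starRingEnd ℂ (c ^ n)))
    have hl : ∀ x, l x = (x * starRingEnd ℂ (c ^ n)).im := fun x => rfl
    obtain ⟨z, hz, hmax⟩ := hKc.exists_isMaxOn hKne l.continuous.continuousOn
    obtain ⟨w, hw, hwz⟩ := exists_mem_sub_eq_two_mul_pow hKinv n z hz
    have hcn : l (c ^ n) = 0 := by rw [hl, Complex.mul_conj, Complex.ofReal_im]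
    have hl2 : l (2 * c ^ n) = 0 := by rw [two_mul, map_add, hcn, add_zero]
    have hne : z ≠ w := by
      rintro rfl
      have := pow_ne_zero n hc
      simp [this] at hwz
    have hlw : l w = l z := by
      rw [← sub_eq_zero, ← map_sub]
      rcases hwz with h | h <;> rw [h]
      · exact hl2
      · rw [map_neg, hl2, neg_zero]
    obtain ⟨p, hp, q, hq, hpq, hlpq⟩ :=
      exists_ne_extremePoints_of_isMaxOn hKc l hz hw hne hmax hlw
    refine ⟨(⟨p, hp⟩, ⟨q, hq⟩), sub_ne_zero.2 hpq, ?_⟩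
    rw [← hl, map_sub, hlpq, sub_self]
  choose f hf0 hf using hpair
  have := hfin.to_subtype
  obtain ⟨m, n, hmn, hfmn⟩ := Finite.exists_ne_map_eq_of_infinite f
  exact hpow m n hmn (im_mul_conj_eq_zero (hf0 m) (hf m) (hfmn ▸ hf n))
end

section
/- Let α = r·π with r irrational, and let φ₁(z) = (1/3)·exp(√−1·α)·z − 1 and φ₂(z) = (1/3)·exp(√−1·α)·z + 1. Let K ⊆ ℂ be the attractor of (φ₁, φ₂) and K̃ = convexHull ℝ K. Then the 1-dimensional Hausdorff measure of the boundary of K̃ equals 6: μH[1](frontier K̃) = 6. -/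
open Set MeasureTheory

/-- The cross product with `v` on the plane, as a real linear functional. -/
noncomputable def crossCLM (v : ℂ) : ℂ →L[ℝ] ℝ := v.re • Complex.imCLM - v.im • Complex.reCLM

lemma crossCLM_apply (v z : ℂ) : crossCLM v z = v.re * z.im - v.im * z.re := by
  simp [crossCLM]

lemma crossCLM_self (v : ℂ) : crossCLM v v = 0 := by
  rw [crossCLM_apply]; ring

lemma eq_combination_of_crossCLM_ne_zero {v w : ℂ} (h : crossCLM v w ≠ 0) (z : ℂ) :
    z = (crossCLM z w / crossCLM v w) • v + (crossCLM v z / crossCLM v w) • w := by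
  apply Complex.ext
  · simp only [Complex.add_re, Complex.real_smul, Complex.re_ofReal_mul]
    field_simp
    simp only [crossCLM_apply]
    ring
  · simp only [Complex.add_im, Complex.real_smul, Complex.im_ofReal_mul]
    field_simp
    simp only [crossCLM_apply]
    ring

lemma eq_zero_of_crossCLM_eq_zero {v w z : ℂ} (h : crossCLM v w ≠ 0) (hv : crossCLM v z = 0)
    (hw : crossCLM w z = 0) : z = 0 := by
  rw [eq_combination_of_crossCLM_ne_zero h z, hv]
  have : crossCLM z w = 0 := by
    rw [crossCLM_apply] at hw ⊢
    linarith
  simp [this]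

lemma clm_eq_zero_of_crossCLM_ne_zero {v w : ℂ} (h : crossCLM v w ≠ 0) {f : ℂ →L[ℝ] ℝ}
    (hv : f v = 0) (hw : f w = 0) : f = 0 := by
  ext z
  rw [eq_combination_of_crossCLM_ne_zero h z]
  rw [map_add, map_smul, map_smul, hv, hw]
  simp

lemma clm_eq_smul_crossCLM {v : ℂ} (hv0 : v ≠ 0) {f : ℂ →L[ℝ] ℝ} (hv : f v = 0) :
    ∃ c : ℝ, f = c • crossCLM v := by
  have hf : ∀ z : ℂ, f z = z.re * f 1 + z.im * f Complex.I := by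
    intro z
    have : z = z.re • (1 : ℂ) + z.im • Complex.I := by
      simp [Complex.re_add_im]
    conv_lhs => rw [this, map_add, map_smul, map_smul, smul_eq_mul, smul_eq_mul]
  have hn : Complex.normSq v ≠ 0 := by simpa using hv0
  rw [Complex.normSq_apply] at hn
  refine ⟨(v.re * f Complex.I - v.im * f 1) / (v.re * v.re + v.im * v.im),
    ContinuousLinearMap.ext fun z => ?_⟩
  rw [hf] at hv
  rw [hf z, smul_apply, crossCLM_apply, smul_eq_mul, div_mul_eq_mul_div, eq_div_iff hn]
  linear_combination (z.re * v.re + z.im * v.im) * hv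

/-- All the sums `∑ ± w k`. -/
def signSums (w : ℕ → ℂ) : Set ℂ :=
  {z | ∃ ε : ℕ → ℝ, (∀ k, ε k = 1 ∨ ε k = -1) ∧ HasSum (fun k => ε k • w k) z}

/-- The Minkowski sum of the segments `[-w k, w k]`. -/
def zonoid (w : ℕ → ℂ) : Set ℂ :=
  {z | ∃ t : ℕ → ℝ, (∀ k, |t k| ≤ 1) ∧ HasSum (fun k => t k • w k) z}

section SignSums

variable {w : ℕ → ℂ}

lemma summable_smul_of_abs_le_one (hw : Summable fun k => ‖w k‖) {t : ℕ → ℝ}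
    (ht : ∀ k, |t k| ≤ 1) : Summable fun k => t k • w k := by
  refine .of_norm_bounded hw fun k => ?_
  rw [norm_smul, Real.norm_eq_abs]
  exact mul_le_of_le_one_left (norm_nonneg _) (ht k)

lemma abs_le_one_of_sign {a : ℝ} (h : a = 1 ∨ a = -1) : |a| ≤ 1 := by
  rcases h with rfl | rfl <;> simp

lemma signSums_subset_zonoid : signSums w ⊆ zonoid w :=
  fun _ ⟨ε, hε, hz⟩ => ⟨ε, fun k => abs_le_one_of_sign (hε k), hz⟩

lemma convex_zonoid : Convex ℝ (zonoid w) := by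
  rintro x ⟨s, hs, hx⟩ y ⟨t, ht, hy⟩ a b ha hb hab
  refine ⟨fun k => a * s k + b * t k, fun k => ?_, ?_⟩
  · calc |a * s k + b * t k| ≤ |a * s k| + |b * t k| := abs_add_le _ _
      _ = a * |s k| + b * |t k| := by rw [abs_mul, abs_mul, abs_of_nonneg ha, abs_of_nonneg hb]
      _ ≤ a * 1 + b * 1 := by gcongr <;> simp [hs, ht]
      _ = 1 := by linarith
  · simpa [add_smul, mul_smul] using (hx.const_smul a).add (hy.const_smul b)

lemma isCompact_zonoid (hw : Summable fun k => ‖w k‖) : IsCompact (zonoid w) := by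
  have himage : zonoid w =
      (fun t : ℕ → ℝ => ∑' k, t k • w k) '' (Set.univ.pi fun _ => Icc (-1 : ℝ) 1) := by
    ext z
    constructor
    · rintro ⟨t, ht, hz⟩
      exact ⟨t, fun k _ => abs_le.1 (ht k), hz.tsum_eq⟩
    · rintro ⟨t, ht, rfl⟩
      have ht' : ∀ k, |t k| ≤ 1 := fun k => abs_le.2 (ht k (mem_univ k))
      exact ⟨t, ht', (summable_smul_of_abs_le_one hw ht').hasSum⟩
  rw [himage]
  refine (isCompact_univ_pi fun _ => isCompact_Icc).image_of_continuousOn ?_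
  refine continuousOn_tsum (fun k => by fun_prop) hw fun k t ht => ?_
  rw [norm_smul, Real.norm_eq_abs]
  exact mul_le_of_le_one_left (norm_nonneg _) (abs_le.2 (ht k (mem_univ k)))

lemma closure_convexHull_signSums_subset (hw : Summable fun k => ‖w k‖) :
    closure (convexHull ℝ (signSums w)) ⊆ zonoid w :=
  closure_minimal (convexHull_min signSums_subset_zonoid convex_zonoid)
    (isCompact_zonoid hw).isClosed

/-- A functional attains its maximum over the sign sums only at the coefficients of maximal
value. -/
lemma coeff_mul_eq_abs_of_isMax (hw : Summable fun k => ‖w k‖) {f : ℂ →L[ℝ] ℝ} {z : ℂ}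
    {t : ℕ → ℝ} (ht : ∀ k, |t k| ≤ 1) (hz : HasSum (fun k => t k • w k) z)
    (hmax : ∀ y ∈ signSums w, f y ≤ f z) (k : ℕ) : t k * f (w k) = |f (w k)| := by
  set ε : ℕ → ℝ := fun j => if 0 ≤ f (w j) then 1 else -1 with hε
  have hε1 : ∀ j, ε j = 1 ∨ ε j = -1 := fun j => by
    simp only [hε]; split_ifs <;> simp
  have hεf : ∀ j, ε j * f (w j) = |f (w j)| := fun j => by
    simp only [hε]
    split_ifs with h
    · rw [one_mul, abs_of_nonneg h]
    · rw [abs_of_neg (not_le.1 h), neg_one_mul]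
  have hy := (summable_smul_of_abs_le_one hw fun j => abs_le_one_of_sign (hε1 j)).hasSum
  have hle := hmax _ ⟨ε, hε1, hy⟩
  have hd := (f.hasSum hy).sub (f.hasSum hz)
  simp only [map_smul, smul_eq_mul, hεf] at hd
  have hnn : ∀ j, 0 ≤ |f (w j)| - t j * f (w j) := fun j => by
    have h1 : |t j * f (w j)| ≤ |f (w j)| := by
      rw [abs_mul]; exact mul_le_of_le_one_left (abs_nonneg _) (ht j)
    linarith [le_abs_self (t j * f (w j))]
  have h0 := le_antisymm (sub_nonpos.2 hle) (hd.nonneg hnn)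
  rw [h0] at hd
  have := congrFun ((hasSum_zero_iff_of_nonneg hnn).1 hd) k
  simp only [Pi.zero_apply] at this
  linarith

lemma two_smul_mem_vectorSpan_signSums (hw : Summable fun k => ‖w k‖) (k : ℕ) :
    (2 : ℝ) • w k ∈ vectorSpan ℝ (signSums w) := by
  have h1 := (summable_smul_of_abs_le_one hw (t := fun _ => 1) (by simp)).hasSum
  have h2 := h1.sub (hasSum_ite_eq k ((2 : ℝ) • w k))
  have hm1 : (∑' j, (1 : ℝ) • w j) ∈ signSums w := ⟨fun _ => 1, by simp, h1⟩
  have hm2 : (∑' j, (1 : ℝ) • w j) - (2 : ℝ) • w k ∈ signSums w := by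
    refine ⟨fun j => if j = k then -1 else 1, fun j => by dsimp only; split_ifs <;> simp, ?_⟩
    have heq : (fun j => (if j = k then (-1 : ℝ) else 1) • w j) =
        fun j => (1 : ℝ) • w j - if j = k then (2 : ℝ) • w k else 0 := by
      funext j
      split_ifs with h
      · subst h; module
      · module
    rwa [heq]
  simpa using vsub_mem_vectorSpan ℝ hm1 hm2

lemma interior_convexHull_signSums_nonempty (hw : Summable fun k => ‖w k‖)
    (h01 : crossCLM (w 0) (w 1) ≠ 0) : (interior (convexHull ℝ (signSums w))).Nonempty := by
  have hne : (signSums w).Nonempty :=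
    ⟨_, fun _ => 1, by simp, (summable_smul_of_abs_le_one hw (t := fun _ => 1) (by simp)).hasSum⟩
  have hmem : ∀ k, w k ∈ vectorSpan ℝ (signSums w) := fun k => by
    simpa [smul_smul] using
      Submodule.smul_mem _ (1 / 2 : ℝ) (two_smul_mem_vectorSpan_signSums hw k)
  rw [interior_convexHull_nonempty_iff_affineSpan_eq_top,
    AffineSubspace.affineSpan_eq_top_iff_vectorSpan_eq_top_of_nonempty _ _ _ hne, eq_top_iff]
  intro z _
  rw [eq_combination_of_crossCLM_ne_zero h01 z]
  exact add_mem (Submodule.smul_mem _ _ (hmem 0)) (Submodule.smul_mem _ _ (hmem 1))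

/-- Boundary points of a convex set with nonempty interior have a supporting functional. -/
lemma exists_supporting_functional {s : Set ℂ} (hs : Convex ℝ s) (hi : (interior s).Nonempty)
    {p : ℂ} (hp : p ∈ frontier s) : ∃ f : ℂ →L[ℝ] ℝ, f ≠ 0 ∧ ∀ y ∈ s, f y ≤ f p := by
  obtain ⟨f, hf⟩ := geometric_hahn_banach_open_point hs.interior isOpen_interior hp.2
  refine ⟨f, ?_, fun y hy => ?_⟩
  · rintro rfl
    obtain ⟨a, ha⟩ := hi
    simpa using hf a ha
  · have hsub : closure (interior s) ⊆ {y | f y ≤ f p} :=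
      closure_minimal (fun a ha => (hf a ha).le) (isClosed_le f.continuous continuous_const)
    rw [hs.closure_interior_eq_closure_of_nonempty_interior hi] at hsub
    exact hsub (subset_closure hy)

/-- A point of a set where a nonzero functional is maximal lies on the boundary. -/
lemma mem_frontier_of_isMax {s : Set ℂ} {p : ℂ} (hp : p ∈ s) {f : ℂ →L[ℝ] ℝ} (hf : f ≠ 0)
    (hmax : ∀ y ∈ s, f y ≤ f p) : p ∈ frontier s := by
  refine ⟨subset_closure hp, fun hi => hf ?_⟩
  have hloc : IsLocalMax f p :=
    Filter.mem_of_superset (mem_interior_iff_mem_nhds.1 hi) hmax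
  exact hloc.hasFDerivAt_eq_zero f.hasFDerivAt

/-- The sum of the `w j`, oriented to lie to the left of `w k`. -/
noncomputable def edgeCenter (w : ℕ → ℂ) (k : ℕ) : ℂ :=
  ∑' j, (SignType.sign (crossCLM (w k) (w j)) : ℝ) • w j

/-- The two edges of the zonoid in the direction of `w k`. -/
noncomputable def edge (w : ℕ → ℂ) (k : ℕ) (b : Bool) : Set ℂ :=
  segment ℝ ((cond b 1 (-1) : ℝ) • edgeCenter w k - w k)
    ((cond b 1 (-1) : ℝ) • edgeCenter w k + w k)

lemma abs_sign_le_one (a : ℝ) : |(SignType.sign a : ℝ)| ≤ 1 := by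
  rcases lt_trichotomy a 0 with h | rfl | h <;> simp [*]

lemma hasSum_edgeCenter (hw : Summable fun k => ‖w k‖) (k : ℕ) :
    HasSum (fun j => (SignType.sign (crossCLM (w k) (w j)) : ℝ) • w j) (edgeCenter w k) :=
  (summable_smul_of_abs_le_one hw fun _ => abs_sign_le_one _).hasSum

lemma add_smul_mem_segment (c v : ℂ) {t : ℝ} (ht : |t| ≤ 1) :
    c + t • v ∈ segment ℝ (c - v) (c + v) := by
  obtain ⟨h1, h2⟩ := abs_le.1 ht
  exact ⟨(1 - t) / 2, (1 + t) / 2, by linarith, by linarith, by ring, by module⟩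

lemma abs_cond (b : Bool) : |(cond b 1 (-1) : ℝ)| = 1 := by cases b <;> simp

lemma frontier_subset_signSums_union_edges (hw : Summable fun k => ‖w k‖)
    (hcross : ∀ j k, j ≠ k → crossCLM (w j) (w k) ≠ 0) :
    frontier (convexHull ℝ (signSums w)) ⊆ signSums w ∪ ⋃ i : ℕ × Bool, edge w i.1 i.2 := by
  intro p hp
  obtain ⟨f, hf, hmax⟩ := exists_supporting_functional (convex_convexHull ℝ _)
    (interior_convexHull_signSums_nonempty hw (hcross 0 1 (by simp))) hp
  obtain ⟨t, ht, hz⟩ := closure_convexHull_signSums_subset hw hp.1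
  have hcoeff := coeff_mul_eq_abs_of_isMax hw ht hz
    fun y hy => hmax y (subset_convexHull ℝ _ hy)
  by_cases hk : ∃ k, f (w k) = 0
  · right
    obtain ⟨k, hk⟩ := hk
    have hwk : w k ≠ 0 := fun h => hcross k (k + 1) (by simp) (by simp [h, crossCLM_apply])
    obtain ⟨c, rfl⟩ := clm_eq_smul_crossCLM hwk hk
    have hc : c ≠ 0 := by rintro rfl; simp at hf
    obtain ⟨b, hb⟩ : ∃ b : Bool, |c| = (cond b 1 (-1)) * c := by
      rcases abs_choice c with h | h
      · exact ⟨true, by simpa using h⟩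
      · exact ⟨false, by simpa using h⟩
    have hbsq : (cond b 1 (-1) : ℝ) * cond b 1 (-1) = 1 := by cases b <;> simp
    have htj : ∀ j, j ≠ k → t j = cond b 1 (-1) * SignType.sign (crossCLM (w k) (w j)) := by
      intro j hj
      have hg := hcross k j hj.symm
      have := hcoeff j
      simp only [smul_apply, smul_eq_mul, abs_mul, hb] at this
      rw [← sign_mul_self (crossCLM (w k) (w j))] at this
      refine mul_right_cancel₀ (mul_ne_zero hc hg) ?_
      linear_combination this
    have hd := hz.sub ((hasSum_edgeCenter hw k).const_smul (cond b 1 (-1) : ℝ))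
    have hs := hasSum_single k (f := fun j => t j • w j -
      (cond b 1 (-1) : ℝ) • (SignType.sign (crossCLM (w k) (w j)) : ℝ) • w j) fun j hj => by
        rw [htj j hj, mul_smul, sub_self]
    have heq := hd.unique hs
    simp only [crossCLM_self, sign_zero, SignType.coe_zero, zero_smul, smul_zero, sub_zero] at heq
    refine mem_iUnion.2 ⟨(k, b), ?_⟩
    rw [sub_eq_iff_eq_add'.1 heq]
    exact add_smul_mem_segment _ _ (ht k)
  · left
    push Not at hk
    refine ⟨t, fun k => ?_, hz⟩
    have h := hcoeff k
    rcases abs_choice (f (w k)) with h' | h' <;> rw [h'] at h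
    · exact .inl (mul_right_cancel₀ (hk k) (by linarith))
    · exact .inr (mul_right_cancel₀ (hk k) (by linarith))

lemma crossCLM_eq_of_mem_edge {k : ℕ} {b : Bool} {p : ℂ} (hp : p ∈ edge w k b) :
    crossCLM (w k) p = cond b 1 (-1) * crossCLM (w k) (edgeCenter w k) := by
  obtain ⟨x, y, -, -, hxy, rfl⟩ := hp
  simp only [map_add, map_smul, map_sub, crossCLM_self, smul_eq_mul]
  linear_combination (cond b 1 (-1) * crossCLM (w k) (edgeCenter w k)) * hxy

lemma hasSum_abs_crossCLM (hw : Summable fun k => ‖w k‖) (k : ℕ) :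
    HasSum (fun j => |crossCLM (w k) (w j)|) (crossCLM (w k) (edgeCenter w k)) := by
  simpa only [map_smul, smul_eq_mul, sign_mul_self] using
    (crossCLM (w k)).hasSum (hasSum_edgeCenter hw k)

lemma abs_crossCLM_le_of_mem_zonoid (hw : Summable fun k => ‖w k‖) (k : ℕ) {z : ℂ}
    (hz : z ∈ zonoid w) : |crossCLM (w k) z| ≤ crossCLM (w k) (edgeCenter w k) := by
  obtain ⟨t, ht, hz⟩ := hz
  have hz' := (crossCLM (w k)).hasSum hz
  simp only [map_smul, smul_eq_mul] at hz'
  have hle : ∀ j, |t j * crossCLM (w k) (w j)| ≤ |crossCLM (w k) (w j)| := fun j => by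
    rw [abs_mul]; exact mul_le_of_le_one_left (abs_nonneg _) (ht j)
  refine abs_le.2 ⟨?_, ?_⟩
  · exact hasSum_le (fun j => (abs_le.1 (hle j)).1) (hasSum_abs_crossCLM hw k).neg hz'
  · exact hasSum_le (fun j => (abs_le.1 (hle j)).2) hz' (hasSum_abs_crossCLM hw k)

lemma crossCLM_edgeCenter_pos (hw : Summable fun k => ‖w k‖)
    (hcross : ∀ j k, j ≠ k → crossCLM (w j) (w k) ≠ 0) (k : ℕ) :
    0 < crossCLM (w k) (edgeCenter w k) :=
  (abs_pos.2 (hcross k (k + 1) (by simp))).trans_le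
    (le_hasSum (hasSum_abs_crossCLM hw k) (k + 1) fun _ _ => abs_nonneg _)

lemma edge_endpoint_mem_signSums (hw : Summable fun k => ‖w k‖)
    (hcross : ∀ j k, j ≠ k → crossCLM (w j) (w k) ≠ 0) (k : ℕ) (b : Bool) {a : ℝ}
    (ha : a = 1 ∨ a = -1) : (cond b 1 (-1) : ℝ) • edgeCenter w k + a • w k ∈ signSums w := by
  refine ⟨fun j => if j = k then a else cond b 1 (-1) * SignType.sign (crossCLM (w k) (w j)),
    fun j => ?_, ?_⟩
  · dsimp only
    split_ifs with h
    · exact ha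
    · rcases (hcross k j (Ne.symm h)).lt_or_gt with h | h <;> cases b <;> simp [h]
  · have h := ((hasSum_edgeCenter hw k).const_smul (cond b 1 (-1) : ℝ)).add
      (hasSum_ite_eq k (a • w k))
    have heq : (fun j => (if j = k then a else
        cond b 1 (-1) * (SignType.sign (crossCLM (w k) (w j)) : ℝ)) • w j) =
        fun j => (cond b 1 (-1) : ℝ) • (SignType.sign (crossCLM (w k) (w j)) : ℝ) • w j +
          if j = k then a • w k else 0 := by
      funext j
      split_ifs with h
      · subst h; simp [crossCLM_self]
      · rw [mul_smul, add_zero]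
    rwa [heq]

lemma edge_subset_frontier (hw : Summable fun k => ‖w k‖)
    (hcross : ∀ j k, j ≠ k → crossCLM (w j) (w k) ≠ 0) (k : ℕ) (b : Bool) :
    edge w k b ⊆ frontier (convexHull ℝ (signSums w)) := by
  intro p hp
  have h1 := edge_endpoint_mem_signSums hw hcross k b (a := 1) (.inl rfl)
  have h2 := edge_endpoint_mem_signSums hw hcross k b (a := -1) (.inr rfl)
  rw [one_smul] at h1
  rw [neg_one_smul, ← sub_eq_add_neg] at h2
  have hmem : p ∈ convexHull ℝ (signSums w) := segment_subset_convexHull h2 h1 hp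
  have hb : (cond b 1 (-1) : ℝ) * cond b 1 (-1) = 1 := by cases b <;> simp
  refine mem_frontier_of_isMax hmem (f := (cond b 1 (-1) : ℝ) • crossCLM (w k)) ?_ fun y hy => ?_
  · intro h0
    refine hcross k (k + 1) (by simp) ?_
    have := DFunLike.congr_fun h0 (w (k + 1))
    cases b <;> simpa using this
  · rw [smul_apply, smul_apply, crossCLM_eq_of_mem_edge hp, smul_eq_mul, smul_eq_mul,
      ← mul_assoc, hb, one_mul]
    refine (le_abs_self _).trans ?_
    rw [abs_mul, abs_cond, one_mul]
    exact abs_crossCLM_le_of_mem_zonoid hw k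
      (closure_convexHull_signSums_subset hw (subset_closure hy))

lemma edge_inter_subsingleton (hw : Summable fun k => ‖w k‖)
    (hcross : ∀ j k, j ≠ k → crossCLM (w j) (w k) ≠ 0) {i j : ℕ × Bool} (hij : i ≠ j) :
    (edge w i.1 i.2 ∩ edge w j.1 j.2).Subsingleton := by
  obtain ⟨k, b⟩ := i
  obtain ⟨l, c⟩ := j
  rintro x ⟨hx1, hx2⟩ y ⟨hy1, hy2⟩
  by_cases hkl : k = l
  · subst hkl
    have hpos := crossCLM_edgeCenter_pos hw hcross k
    have h := (crossCLM_eq_of_mem_edge hx1).symm.trans (crossCLM_eq_of_mem_edge hx2)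
    have := mul_right_cancel₀ hpos.ne' h
    cases b <;> cases c <;> simp at hij this <;> linarith
  · refine sub_eq_zero.1 (eq_zero_of_crossCLM_eq_zero (hcross k l hkl) ?_ ?_)
    · rw [map_sub, crossCLM_eq_of_mem_edge hx1, crossCLM_eq_of_mem_edge hy1, sub_self]
    · rw [map_sub, crossCLM_eq_of_mem_edge hx2, crossCLM_eq_of_mem_edge hy2, sub_self]

lemma hausdorffMeasure_edge (k : ℕ) (b : Bool) :
    μH[1] (edge w k b) = ENNReal.ofReal (2 * ‖w k‖) := by
  rw [edge, hausdorffMeasure_segment, edist_dist, dist_eq_norm]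
  congr 1
  rw [show (cond b 1 (-1) : ℝ) • edgeCenter w k - w k -
    ((cond b 1 (-1) : ℝ) • edgeCenter w k + w k) = (-2 : ℝ) • w k by module, norm_smul]
  simp

/-- The perimeter of the convex hull of the sign sums of pairwise non-parallel vectors. -/
theorem hausdorffMeasure_frontier_convexHull_signSums (hw : Summable fun k => ‖w k‖)
    (hcross : ∀ j k, j ≠ k → crossCLM (w j) (w k) ≠ 0) (hnull : μH[1] (signSums w) = 0) :
    μH[1] (frontier (convexHull ℝ (signSums w))) = ENNReal.ofReal (∑' k, 4 * ‖w k‖) := by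
  have hU : μH[1] (frontier (convexHull ℝ (signSums w))) =
      μH[1] (⋃ i : ℕ × Bool, edge w i.1 i.2) := by
    refine le_antisymm ?_ (measure_mono (iUnion_subset fun i => edge_subset_frontier hw hcross _ _))
    calc _ ≤ _ := measure_mono (frontier_subset_signSums_union_edges hw hcross)
      _ ≤ _ := measure_union_le _ _
      _ = _ := by rw [hnull, zero_add]
  have hmeas : ∀ i : ℕ × Bool, NullMeasurableSet (edge w i.1 i.2) (μH[1] : Measure ℂ) := fun i => by
    have hc : IsCompact (edge w i.1 i.2) := by
      rw [edge, segment_eq_image]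
      exact isCompact_Icc.image (by fun_prop)
    exact hc.measurableSet.nullMeasurableSet
  have := Measure.nullSingletonClass_hausdorff ℂ (d := 1) one_pos
  have hdisj : Pairwise (Function.onFun (AEDisjoint (μH[1] : Measure ℂ))
      fun i : ℕ × Bool => edge w i.1 i.2) := fun i j hij =>
    (edge_inter_subsingleton hw hcross hij).measure_zero _
  rw [hU, measure_iUnion₀ hdisj hmeas,
    ENNReal.tsum_prod (f := fun k b => μH[1] (edge w k b)),
    ENNReal.ofReal_tsum_of_nonneg (fun k => by positivity) (hw.mul_left 4)]
  refine tsum_congr fun k => ?_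
  rw [tsum_bool, hausdorffMeasure_edge, hausdorffMeasure_edge,
    ← ENNReal.ofReal_add (by positivity) (by positivity)]
  congr 1
  ring

end SignSums

lemma iterate_inverse_branches {c : ℂ} {K : Set ℂ}
    (hK : ∀ z ∈ K, ∃ e : ℝ, (e = 1 ∨ e = -1) ∧ ∃ x ∈ K, z = c * x + e) {z : ℂ} (hz : z ∈ K) :
    ∃ ε : ℕ → ℝ, (∀ k, ε k = 1 ∨ ε k = -1) ∧
      ∀ n, ∃ x ∈ K, z = ∑ k ∈ Finset.range n, ε k • c ^ k + c ^ n * x := by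
  choose! e he x hx hzx using hK
  have hmem : ∀ n, x^[n] z ∈ K := fun n => by
    induction n with
    | zero => exact hz
    | succ n ih => rw [Function.iterate_succ_apply']; exact hx _ ih
  refine ⟨fun k => e (x^[k] z), fun k => he _ (hmem k), fun n => ⟨x^[n] z, hmem n, ?_⟩⟩
  induction n with
  | zero => simp
  | succ n ih =>
    rw [Finset.sum_range_succ, Function.iterate_succ_apply', Complex.real_smul]
    linear_combination ih + c ^ n * hzx _ (hmem n)

lemma sum_sign_pow_add_mem {c : ℂ} {K : Set ℂ}
    (hK : ∀ x ∈ K, ∀ e : ℝ, e = 1 ∨ e = -1 → c * x + e ∈ K) {x : ℂ} (hx : x ∈ K) (n : ℕ) :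
    ∀ ε : ℕ → ℝ, (∀ k, ε k = 1 ∨ ε k = -1) →
      ∑ k ∈ Finset.range n, ε k • c ^ k + c ^ n * x ∈ K := by
  induction n with
  | zero => intro ε _; simpa using hx
  | succ n ih =>
    intro ε hε
    have := hK _ (ih (fun k => ε (k + 1)) fun k => hε _) (ε 0) (hε 0)
    convert this using 1
    rw [Finset.sum_range_succ', mul_add, Finset.mul_sum]
    simp only [Complex.real_smul, pow_succ, pow_zero, mul_one]
    rw [Finset.sum_congr rfl fun k _ => show (ε (k + 1) : ℂ) * (c ^ k * c) =
      c * (ε (k + 1) * c ^ k) by ring]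
    ring

lemma tendsto_pow_mul_of_isCompact {c : ℂ} (hc : ‖c‖ < 1) {K : Set ℂ} (hKc : IsCompact K)
    {x : ℕ → ℂ} (hx : ∀ n, x n ∈ K) : Filter.Tendsto (fun n => c ^ n * x n) Filter.atTop (nhds 0) := by
  obtain ⟨R, hR⟩ := hKc.isBounded.exists_norm_le
  refine squeeze_zero_norm (a := fun n => ‖c‖ ^ n * R) (fun n => ?_) ?_
  · rw [norm_mul, norm_pow]
    gcongr
    exact hR _ (hx n)
  · simpa using (tendsto_pow_atTop_nhds_zero_of_lt_one (norm_nonneg c) hc).mul_const R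

/-- The attractor of `z ↦ c z ± 1` is the set of sums `∑ ± c ^ k`. -/
lemma attractor_eq_signSums {c : ℂ} (hc : ‖c‖ < 1) {K : Set ℂ} (hKc : IsCompact K)
    (hKne : K.Nonempty) (hK : ∀ z ∈ K, ∃ e : ℝ, (e = 1 ∨ e = -1) ∧ ∃ x ∈ K, z = c * x + e)
    (hK' : ∀ x ∈ K, ∀ e : ℝ, e = 1 ∨ e = -1 → c * x + e ∈ K) :
    K = signSums fun k => c ^ k := by
  have hsum : Summable fun k => ‖c ^ k‖ := by
    simpa using summable_geometric_of_lt_one (norm_nonneg c) hc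
  ext z
  constructor
  · intro hz
    obtain ⟨ε, hε, hx⟩ := iterate_inverse_branches hK hz
    choose x hx hzx using hx
    refine ⟨ε, hε, ?_⟩
    have hs := summable_smul_of_abs_le_one hsum fun k => abs_le_one_of_sign (hε k)
    rw [hs.hasSum_iff_tendsto_nat]
    have := (tendsto_const_nhds (x := z)).sub (tendsto_pow_mul_of_isCompact hc hKc hx)
    rw [sub_zero] at this
    exact this.congr fun n => by linear_combination hzx n
  · rintro ⟨ε, hε, hz⟩
    obtain ⟨x, hx⟩ := hKne
    have := hz.tendsto_sum_nat.add (tendsto_pow_mul_of_isCompact hc hKc fun _ => hx)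
    rw [add_zero] at this
    exact hKc.isClosed.mem_of_tendsto this
      (.of_forall fun n => sum_sign_pow_add_mem hK' hx n ε hε)

/-- The attractor of two maps `z ↦ c z ± 1` has zero length if the contraction ratio is less than
one half. -/
lemma hausdorffMeasure_attractor_eq_zero {c : ℂ} (hc : ‖c‖ < 1 / 2) {K : Set ℂ} (hKc : IsCompact K)
    (hK : ∀ z ∈ K, ∃ e : ℝ, (e = 1 ∨ e = -1) ∧ ∃ x ∈ K, z = c * x + e) : μH[1] K = 0 := by
  have hdiam : Metric.ediam K ≠ ⊤ := hKc.isBounded.ediam_ne_top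
  set r : ENNReal := (‖c‖₊ : ENNReal) with hr
  have hr2 : 2 * r < 1 := by
    have : 2 * ‖c‖₊ < 1 := by
      rw [← NNReal.coe_lt_coe]; push_cast; linarith
    rw [hr]
    exact_mod_cast this
  have hr1 : r < 1 := lt_of_le_of_lt (by rw [two_mul]; exact le_self_add) hr2
  let t : ∀ n : ℕ, (Fin n → Bool) → Set ℂ := fun n e =>
    (fun x => ∑ k : Fin n, (cond (e k) 1 (-1) : ℝ) • c ^ (k : ℕ) + c ^ n * x) '' K
  have ht : ∀ n e, Metric.ediam (t n e) ≤ r ^ n * Metric.ediam K := by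
    intro n e
    have hL : LipschitzWith (‖c‖₊ ^ n)
        fun x => ∑ k : Fin n, (cond (e k) 1 (-1) : ℝ) • c ^ (k : ℕ) + c ^ n * x :=
      LipschitzWith.of_dist_le_mul fun x y => by
        rw [dist_add_left, dist_eq_norm, ← mul_sub, norm_mul, norm_pow, dist_eq_norm]
        simp
    simpa only [hr, ENNReal.coe_pow] using hL.ediam_image_le K
  have hcover : ∀ n, K ⊆ ⋃ e, t n e := by
    intro n z hz
    obtain ⟨ε, hε, hx⟩ := iterate_inverse_branches hK hz
    obtain ⟨x, hx, hzx⟩ := hx n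
    refine mem_iUnion.2 ⟨fun k => decide (ε k = 1), x, hx, ?_⟩
    rw [hzx, Finset.sum_range]
    dsimp only
    congr 1
    refine Finset.sum_congr rfl fun k _ => ?_
    rcases hε k with h | h <;> rw [h] <;> norm_num
  have hlim : ∀ q : ENNReal, q < 1 →
      Filter.Tendsto (fun n => q ^ n * Metric.ediam K) Filter.atTop (nhds 0) := fun q hq => by
    simpa using ENNReal.Tendsto.mul_const (ENNReal.tendsto_pow_atTop_nhds_zero_of_lt_one hq)
      (.inr hdiam)
  refine le_antisymm ?_ zero_le
  calc μH[1] K ≤ Filter.liminf (fun n => ∑ e, Metric.ediam (t n e) ^ (1 : ℝ)) Filter.atTop :=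
        Measure.hausdorffMeasure_le_liminf_sum 1 K _ (hlim r hr1) t (.of_forall ht)
          (.of_forall hcover)
    _ ≤ Filter.liminf (fun n => (2 * r) ^ n * Metric.ediam K) Filter.atTop := by
        refine Filter.liminf_le_liminf (.of_forall fun n => ?_)
        refine (Finset.sum_le_card_nsmul _ _ (r ^ n * Metric.ediam K) fun e _ => ?_).trans ?_
        · rw [ENNReal.rpow_one]; exact ht n e
        · simp [mul_pow, mul_assoc]
    _ = 0 := (hlim _ hr2).liminf_eq

lemma crossCLM_pow_ne_zero {ρ α : ℝ} (hρ : ρ ≠ 0) {r : ℝ} (hr : Irrational r)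
    (hα : α = r * Real.pi) {j k : ℕ} (hjk : j ≠ k) :
    crossCLM ((ρ * Complex.exp (Complex.I * α)) ^ j) ((ρ * Complex.exp (Complex.I * α)) ^ k) ≠ 0 := by
  have hpow : ∀ n : ℕ, (ρ * Complex.exp (Complex.I * α)) ^ n =
      ((ρ ^ n : ℝ) : ℂ) * Complex.exp (((n * α : ℝ) : ℂ) * Complex.I) := fun n => by
    rw [mul_pow, ← Complex.exp_nat_mul]
    push_cast
    ring_nf
  have hval : crossCLM ((ρ * Complex.exp (Complex.I * α)) ^ j)
      ((ρ * Complex.exp (Complex.I * α)) ^ k) = ρ ^ j * ρ ^ k * Real.sin (k * α - j * α) := by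
    rw [hpow, hpow, crossCLM_apply, Complex.re_ofReal_mul, Complex.re_ofReal_mul,
      Complex.im_ofReal_mul, Complex.im_ofReal_mul, Complex.exp_ofReal_mul_I_re,
      Complex.exp_ofReal_mul_I_re, Complex.exp_ofReal_mul_I_im, Complex.exp_ofReal_mul_I_im,
      Real.sin_sub]
    ring
  rw [hval]
  refine mul_ne_zero (by positivity) fun h => ?_
  obtain ⟨n, hn⟩ := Real.sin_eq_zero_iff.1 h
  have hmul : ((k : ℤ) - j : ℤ) * r = (n : ℝ) := by
    refine mul_right_cancel₀ Real.pi_ne_zero ?_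
    push_cast
    rw [hn, hα]
    ring
  have hkj : (k : ℤ) - j ≠ 0 := by omega
  exact (hr.intCast_mul hkj).ne_int n hmul

/-- Example 1: for `φ₁ z = (1/3)e^{iα}z - 1`, `φ₂ z = (1/3)e^{iα}z + 1` with `α = rπ`,
`r` irrational, the boundary of the convex hull of the attractor has
1-dimensional Hausdorff measure 6. -/
theorem example_boundary_hausdorff_measure
    (r : ℝ) (hr : Irrational r) (α : ℝ) (hα : α = r * Real.pi)
    (φ₁ φ₂ : ℂ → ℂ)
    (hφ₁ : ∀ z, φ₁ z = (1 / 3 : ℂ) * Complex.exp (Complex.I * (α : ℂ)) * z - 1)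
    (hφ₂ : ∀ z, φ₂ z = (1 / 3 : ℂ) * Complex.exp (Complex.I * (α : ℂ)) * z + 1)
    (K : Set ℂ) (hKne : K.Nonempty) (hKc : IsCompact K)
    (hKinv : K = φ₁ '' K ∪ φ₂ '' K) :
    μH[1] (frontier (convexHull ℝ K)) = 6 := by
  obtain ⟨c, hc⟩ : ∃ c : ℂ, c = ((1 / 3 : ℝ) : ℂ) * Complex.exp (Complex.I * α) := ⟨_, rfl⟩
  have hc3 : (1 / 3 : ℂ) * Complex.exp (Complex.I * (α : ℂ)) = c := by rw [hc]; push_cast; rfl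
  rw [hc3] at hφ₁ hφ₂
  have hnorm : ‖c‖ = 1 / 3 := by
    rw [hc, norm_mul, mul_comm Complex.I, Complex.norm_exp_ofReal_mul_I]
    norm_num
  have hK : ∀ z ∈ K, ∃ e : ℝ, (e = 1 ∨ e = -1) ∧ ∃ x ∈ K, z = c * x + e := by
    intro z hz
    rw [hKinv] at hz
    rcases hz with ⟨x, hx, rfl⟩ | ⟨x, hx, rfl⟩
    · exact ⟨-1, .inr rfl, x, hx, by rw [hφ₁]; push_cast; ring⟩
    · exact ⟨1, .inl rfl, x, hx, by rw [hφ₂]; push_cast; ring⟩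
  have hK' : ∀ x ∈ K, ∀ e : ℝ, e = 1 ∨ e = -1 → c * x + e ∈ K := by
    rintro x hx e (rfl | rfl) <;> rw [hKinv]
    · exact .inr ⟨x, hx, by rw [hφ₂]; push_cast; ring⟩
    · exact .inl ⟨x, hx, by rw [hφ₁]; push_cast; ring⟩
  have hnull := hausdorffMeasure_attractor_eq_zero (by rw [hnorm]; norm_num) hKc hK
  have hKs := attractor_eq_signSums (by rw [hnorm]; norm_num) hKc hKne hK hK'
  have hcross : ∀ j k : ℕ, j ≠ k → crossCLM (c ^ j) (c ^ k) ≠ 0 := fun j k hjk => by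
    rw [hc]; exact crossCLM_pow_ne_zero (by norm_num) hr hα hjk
  have hgeom := (hasSum_geometric_of_lt_one (r := (1 / 3 : ℝ)) (by norm_num) (by norm_num)).mul_left 4
  have hpow : ∀ k : ℕ, ‖c ^ k‖ = (1 / 3) ^ k := fun k => by rw [norm_pow, hnorm]
  have hsum : Summable fun k => ‖c ^ k‖ := by
    simp only [hpow]
    exact summable_geometric_of_lt_one (by norm_num) (by norm_num)
  rw [hKs] at hnull ⊢
  rw [hausdorffMeasure_frontier_convexHull_signSums hsum hcross hnull]
  simp only [hpow]
  rw [hgeom.tsum_eq]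
  norm_num
end

section
/- Let α = r·π with r irrational, and let φ₁(z) = (1/3)·exp(√−1·α)·z − 1 and φ₂(z) = (1/3)·exp(√−1·α)·z + 1. Let K ⊆ ℂ be the attractor of (φ₁, φ₂) and K̃ = convexHull ℝ K. Then the set of extreme points of K̃ has 1-dimensional Hausdorff measure zero: μH[1](extremePoints ℝ K̃) = 0. -/
open Set MeasureTheory

/-- The image of `K` under the composition of the maps `f i` along a word. -/
def wordImage {ι X : Type*} (f : ι → X → X) (K : Set X) : (n : ℕ) → (Fin n → ι) → Set X
  | 0, _ => K
  | n + 1, w => f (w 0) '' wordImage f K n (Fin.tail w)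

theorem subset_iUnion_wordImage {ι X : Type*} {f : ι → X → X} {K : Set X}
    (hK : K ⊆ ⋃ i, f i '' K) (n : ℕ) : K ⊆ ⋃ w, wordImage f K n w := by
  induction n with
  | zero => exact fun x hx => mem_iUnion.2 ⟨Fin.elim0, hx⟩
  | succ n ih =>
    intro x hx
    obtain ⟨i, y, hy, rfl⟩ := mem_iUnion.1 (hK hx)
    obtain ⟨w, hw⟩ := mem_iUnion.1 (ih hy)
    exact mem_iUnion.2 ⟨Fin.cons i w, y, by simpa using hw, by simp⟩

theorem ediam_wordImage_le {ι X : Type*} [PseudoEMetricSpace X] {f : ι → X → X} {c : NNReal}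
    (hf : ∀ i, LipschitzWith c (f i)) (K : Set X) (n : ℕ) (w : Fin n → ι) :
    Metric.ediam (wordImage f K n w) ≤ (c : ENNReal) ^ n * Metric.ediam K := by
  induction n with
  | zero => simp [wordImage]
  | succ n ih =>
    calc Metric.ediam (wordImage f K (n + 1) w)
        ≤ c * Metric.ediam (wordImage f K n (Fin.tail w)) := (hf _).ediam_image_le _
      _ ≤ c * ((c : ENNReal) ^ n * Metric.ediam K) := by gcongr; exact ih _
      _ = (c : ENNReal) ^ (n + 1) * Metric.ediam K := by ring

/-- A bounded set covered by its images under `N` maps of Lipschitz constant `c`, with `N * c < 1`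
and `c < 1`, is null for the one-dimensional Hausdorff measure. -/
theorem hausdorffMeasure_one_eq_zero_of_subset_iUnion_image {ι X : Type*} [Fintype ι]
    [EMetricSpace X] [MeasurableSpace X] [BorelSpace X] {f : ι → X → X} {c : NNReal}
    (hf : ∀ i, LipschitzWith c (f i)) (hc : c < 1) (hcard : (Fintype.card ι : NNReal) * c < 1)
    {K : Set X} (hd : Metric.ediam K ≠ ⊤) (hK : K ⊆ ⋃ i, f i '' K) : μH[1] K = 0 := by
  have htendsto {a : NNReal} (ha : a < 1) :
      Filter.Tendsto (fun n : ℕ => (a : ENNReal) ^ n * Metric.ediam K) Filter.atTop (nhds 0) := by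
    simpa using ENNReal.Tendsto.mul_const
      (ENNReal.tendsto_pow_atTop_nhds_zero_of_lt_one (by exact_mod_cast ha)) (Or.inr hd)
  have hle := Measure.hausdorffMeasure_le_liminf_sum (β := ℕ) (ι := fun n => Fin n → ι) 1 K
    (l := Filter.atTop) (fun n => (c : ENNReal) ^ n * Metric.ediam K) (htendsto hc)
    (fun n => wordImage f K n) (.of_forall fun n w => ediam_wordImage_le hf K n w)
    (.of_forall fun n => subset_iUnion_wordImage hK n)
  have hsum (n : ℕ) : ∑ w : Fin n → ι, Metric.ediam (wordImage f K n w) ^ (1 : ℝ)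
      ≤ (((Fintype.card ι : NNReal) * c : NNReal) : ENNReal) ^ n * Metric.ediam K := by
    calc ∑ w : Fin n → ι, Metric.ediam (wordImage f K n w) ^ (1 : ℝ)
        ≤ ∑ _w : Fin n → ι, (c : ENNReal) ^ n * Metric.ediam K :=
          Finset.sum_le_sum fun w _ => by simpa using ediam_wordImage_le hf K n w
      _ = _ := by simp [mul_pow, mul_assoc]
  refine le_antisymm (hle.trans ?_) bot_le
  rw [← (htendsto hcard).liminf_eq]
  exact Filter.liminf_le_liminf (.of_forall hsum)

/-- Example 1: for `φ₁ z = (1/3)e^{iα}z - 1`, `φ₂ z = (1/3)e^{iα}z + 1` with `α = rπ`,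
`r` irrational, the set of extreme points of the convex hull of the attractor has
1-dimensional Hausdorff measure zero. -/
theorem example_extreme_points_measure_zero
    (r : ℝ) (hr : Irrational r) (α : ℝ) (hα : α = r * Real.pi)
    (φ₁ φ₂ : ℂ → ℂ)
    (hφ₁ : ∀ z, φ₁ z = (1 / 3 : ℂ) * Complex.exp (Complex.I * (α : ℂ)) * z - 1)
    (hφ₂ : ∀ z, φ₂ z = (1 / 3 : ℂ) * Complex.exp (Complex.I * (α : ℂ)) * z + 1)
    (K : Set ℂ) (hKne : K.Nonempty) (hKc : IsCompact K)
    (hKinv : K = φ₁ '' K ∪ φ₂ '' K) :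
    μH[1] (extremePoints ℝ (convexHull ℝ K)) = 0 := by
  refine measure_mono_null extremePoints_convexHull_subset ?_
  have hexp : ‖Complex.exp (Complex.I * (α : ℂ))‖ = 1 := by
    rw [mul_comm, Complex.norm_exp_ofReal_mul_I]
  refine hausdorffMeasure_one_eq_zero_of_subset_iUnion_image (ι := Bool)
    (f := fun b => cond b φ₁ φ₂) (c := 1 / 3) ?_ ?_ ?_ hKc.isBounded.ediam_ne_top ?_
  · rintro (_ | _) <;> refine LipschitzWith.of_dist_le_mul fun x y => ?_
    · simp [hφ₂, dist_eq_norm, ← mul_sub, hexp]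
    · simp [hφ₁, dist_eq_norm, ← mul_sub, hexp]
  · rw [← NNReal.coe_lt_coe]; norm_num
  · rw [← NNReal.coe_lt_coe]; norm_num
  · intro x hx
    rw [hKinv] at hx
    rcases hx with hx | hx
    · exact mem_iUnion.2 ⟨true, hx⟩
    · exact mem_iUnion.2 ⟨false, hx⟩
end

section
/- Suppose the system (φ₁,…,φₙ) satisfies the open convex set condition and let U be the interior of K̃ = convexHull ℝ K. If U is nonempty, then ⋃ᵢ φᵢ(U) ⊆ U and φᵢ(U) ∩ φⱼ(U) = ∅ for all i ≠ j. -/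
open Set

/-- A compact set covered by its images under a family of strict
contractions lies in every nonempty closed set which these contractions map into itself. -/
theorem IsCompact.subset_of_subset_iUnion_image_contraction {ι X : Type*} [MetricSpace X]
    [ProperSpace X] {f : ι → X → X} {q : ι → ℝ} (hq : ∀ i, q i < 1)
    (hf : ∀ i x y, dist (f i x) (f i y) ≤ q i * dist x y) {K C : Set X} (hK : IsCompact K)
    (hKf : K ⊆ ⋃ i, f i '' K) (hC : IsClosed C) (hCne : C.Nonempty)
    (hCf : ∀ i, MapsTo (f i) C C) : K ⊆ C := by
  intro x hx
  obtain ⟨m, hm, hmax⟩ := hK.exists_isMaxOn ⟨x, hx⟩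
    (Metric.continuous_infDist_pt C).continuousOn
  obtain ⟨i, y, hy, rfl⟩ := mem_iUnion.mp (hKf hm)
  obtain ⟨c, hc, hyc⟩ := hC.exists_infDist_eq_dist hCne y
  have h₁ : Metric.infDist (f i y) C ≤ q i * Metric.infDist y C :=
    (Metric.infDist_le_dist_of_mem (hCf i hc)).trans (hyc ▸ hf i y c)
  have h₂ : Metric.infDist y C ≤ Metric.infDist (f i y) C := hmax hy
  have h₃ : Metric.infDist x C ≤ Metric.infDist (f i y) C := hmax hx
  have hy₀ : 0 ≤ Metric.infDist y C := Metric.infDist_nonneg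
  have hx₀ : 0 ≤ Metric.infDist x C := Metric.infDist_nonneg
  rw [hC.mem_iff_infDist_zero hCne]
  have hy₁ : Metric.infDist y C = 0 := by nlinarith [hq i]
  rw [hy₁, mul_zero] at h₁
  linarith

/-- A nonconstant complex affine map sending `K` into itself sends the interior of the convex hull
of `K` into itself. -/
theorem mapsTo_interior_convexHull_of_mul_add {K : Set ℂ} {f : ℂ → ℂ} {c d : ℂ} (hc : c ≠ 0)
    (hf : ∀ z, f z = c * z + d) (hK : MapsTo f K K) :
    MapsTo f (interior (convexHull ℝ K)) (interior (convexHull ℝ K)) := by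
  let g : ℂ →ᵃ[ℝ] ℂ := (LinearMap.mulLeft ℝ c).toAffineMap + AffineMap.const ℝ ℂ d
  have hfg : f = g := by
    ext1 z
    simp [g, hf]
  have hopen : IsOpenMap f := by
    have : f = (Homeomorph.addRight d) ∘ (Homeomorph.mulLeft₀ c hc) := by
      ext1 z
      simp [hf]
    rw [this]
    exact (Homeomorph.addRight d).isOpenMap.comp (Homeomorph.mulLeft₀ c hc).isOpenMap
  rw [mapsTo_iff_image_subset]
  refine (hopen.image_interior_subset _).trans (interior_mono ?_)
  rw [hfg, g.image_convexHull, ← hfg]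
  exact convexHull_mono hK.image_subset

/-- Proposition 2: if the system satisfies the open convex set condition and the interior `U`
of `K̃ = convexHull ℝ K` is nonempty, then `⋃ i, φ i '' U ⊆ U` and the images
`φ i '' U` are pairwise disjoint. -/
theorem interior_convexHull_ocsc
    (n : ℕ) (hn : 2 ≤ n)
    (qs αs : Fin n → ℝ) (zs : Fin n → ℂ)
    (hqs : ∀ i, 0 < qs i ∧ qs i < 1)
    (φ : Fin n → ℂ → ℂ)
    (hφ : ∀ i z, φ i z = (qs i : ℂ) * Complex.exp (Complex.I * (αs i : ℂ)) * (z - zs i) + zs i)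
    (K : Set ℂ) (hKne : K.Nonempty) (hKc : IsCompact K)
    (hKinv : K = ⋃ i, φ i '' K)
    (hOCSC : ∃ O : Set ℂ, O.Nonempty ∧ IsOpen O ∧ Convex ℝ O ∧
      (⋃ i, φ i '' O) ⊆ O ∧ ∀ i j, i ≠ j → φ i '' O ∩ φ j '' O = ∅)
    (U : Set ℂ) (hU : U = interior (convexHull ℝ K)) (hUne : U.Nonempty) :
    (⋃ i, φ i '' U) ⊆ U ∧ ∀ i j, i ≠ j → φ i '' U ∩ φ j '' U = ∅ := by
  subst hU
  obtain ⟨O, hOne, hOo, hOc, hOφ, hOdisj⟩ := hOCSC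
  have hnorm : ∀ i, ‖(qs i : ℂ) * Complex.exp (Complex.I * (αs i : ℂ))‖ = qs i := fun i ↦ by
    rw [norm_mul, mul_comm Complex.I, Complex.norm_exp_ofReal_mul_I, Complex.norm_real, mul_one,
      Real.norm_of_nonneg (hqs i).1.le]
  have hdist : ∀ i x y, dist (φ i x) (φ i y) = qs i * dist x y := fun i x y ↦ by
    rw [dist_eq_norm, dist_eq_norm, ← hnorm i, ← norm_mul, hφ, hφ]
    congr 1
    ring
  have hcont : ∀ i, Continuous (φ i) := fun i ↦ by
    rw [funext (hφ i)]
    fun_prop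
  have hKO : K ⊆ closure O :=
    hKc.subset_of_subset_iUnion_image_contraction (fun i ↦ (hqs i).2)
      (fun i x y ↦ (hdist i x y).le) hKinv.subset isClosed_closure hOne.closure
      fun i ↦ (mapsTo_iff_image_subset.mpr ((subset_iUnion _ i).trans hOφ)).closure (hcont i)
  have hUO : interior (convexHull ℝ K) ⊆ O := by
    have h := interior_mono (convexHull_min hKO hOc.closure)
    rwa [hOc.interior_closure_eq_interior_of_nonempty_interior (by rwa [hOo.interior_eq]),
      hOo.interior_eq] at h
  refine ⟨iUnion_subset fun i ↦ ?_, fun i j hij ↦ ?_⟩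
  · refine (mapsTo_interior_convexHull_of_mul_add
      (c := (qs i : ℂ) * Complex.exp (Complex.I * (αs i : ℂ)))
      (d := zs i - (qs i : ℂ) * Complex.exp (Complex.I * (αs i : ℂ)) * zs i) ?_
      (fun z ↦ ?_) (mapsTo_iff_image_subset.mpr ?_)).image_subset
    · rw [← norm_pos_iff, hnorm]
      exact (hqs i).1
    · rw [hφ]
      ring
    · exact (subset_iUnion (fun i ↦ φ i '' K) i).trans hKinv.superset
  · exact subset_empty_iff.mp
      ((inter_subset_inter (image_mono hUO) (image_mono hUO)).trans (hOdisj i j hij).subset)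
end

section
/- Let n ≥ 2 and let U₁,…,Uₙ ⊆ ℂ be compact convex sets, each with nonempty interior, whose interiors are pairwise disjoint. Let V = convexHull ℝ (⋃ᵢ Uᵢ) and Qᵢ = Uᵢ ∩ frontier V, and let mᵢ be the number of connected components of Qᵢ. Then each mᵢ is finite and ∑ᵢ mᵢ ≤ 2n − 2. -/
open Set

open Finset in
lemma sum_card_image_erase_le {ι α : Type*} [DecidableEq ι] [DecidableEq α] (g : ι → ι → α)
    (h : ∀ i j k, i ≠ j → k ≠ i → k ≠ j → g i k = g i j ∨ g j k = g j i)
    (s : Finset ι) (hs : s.Nonempty) :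
    ∑ i ∈ s, #((s.erase i).image (g i)) + 2 ≤ 2 * #s := by
  induction hn : #s generalizing s with
  | zero => simp_all
  | succ n ih =>
  rcases Nat.eq_zero_or_pos n with rfl | hn0
  · obtain ⟨a, rfl⟩ := card_eq_one.1 hn
    simp
  obtain ⟨⟨i, j⟩, hij, hmin⟩ := exists_min_image s.offDiag
    (fun q : ι × ι => #{k ∈ s.erase q.1 | g q.1 k = g q.1 q.2})
    (by obtain ⟨a, ha, b, hb, hab⟩ := one_lt_card.1 (by lia : 1 < #s)
        exact ⟨(a, b), mem_offDiag.2 ⟨ha, hb, hab⟩⟩)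
  obtain ⟨hi, hj, hne⟩ := mem_offDiag.1 hij
  have hleaf : ∀ k ∈ s.erase j, g j k = g j i := by
    intro k hk
    by_contra hki
    have hkj := ne_of_mem_erase hk
    refine absurd (hmin (j, k) (mem_offDiag.2 ⟨hj, mem_of_mem_erase hk, hkj.symm⟩))
      (not_le.2 (card_lt_card ?_))
    rw [Finset.ssubset_iff_of_subset]
    · exact ⟨j, by simp [hj, Ne.symm hne], by simp⟩
    · intro l hl
      simp only [mem_filter, mem_erase] at hl ⊢
      have hli : l ≠ i := fun e => hki (by rw [← hl.2, e])
      refine ⟨⟨hli, hl.1.2⟩, (h i j l hne hli hl.1.1).resolve_right fun e => hki ?_⟩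
      rw [← hl.2, e]
  have hcj : #((s.erase j).image (g j)) ≤ 1 := by
    refine card_le_one.2 fun a ha b hb => ?_
    obtain ⟨k, hk, rfl⟩ := mem_image.1 ha
    obtain ⟨l, hl, rfl⟩ := mem_image.1 hb
    rw [hleaf k hk, hleaf l hl]
  have hcard : #(s.erase j) = n := by rw [card_erase_of_mem hj, hn]; rfl
  have hrec := ih (s.erase j) ⟨i, mem_erase.2 ⟨hne, hi⟩⟩ hcard
  have hstep : ∀ k ∈ s.erase j, #((s.erase k).image (g k)) ≤
      #(((s.erase j).erase k).image (g k)) +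
        if g k j ∈ ((s.erase j).erase k).image (g k) then 0 else 1 := by
    intro k hk
    have : s.erase k = insert j ((s.erase j).erase k) := by
      rw [erase_right_comm, insert_erase (mem_erase.2 ⟨(ne_of_mem_erase hk).symm, hj⟩)]
    rw [this, image_insert]
    split_ifs with hm
    · rw [Finset.insert_eq_of_mem hm, add_zero]
    · exact card_insert_le _ _
  have hone : ∑ k ∈ s.erase j,
      (if g k j ∈ ((s.erase j).erase k).image (g k) then 0 else 1) ≤ 1 := by
    rw [sum_ite, sum_const_zero, zero_add, ← card_eq_sum_ones]
    refine card_le_one.2 fun a ha b hb => ?_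
    simp only [mem_filter] at ha hb
    by_contra hab
    rcases h a b j hab (ne_of_mem_erase ha.1).symm (ne_of_mem_erase hb.1).symm with e | e
    · exact ha.2 (mem_image.2 ⟨b, mem_erase.2 ⟨Ne.symm hab, hb.1⟩, e.symm⟩)
    · exact hb.2 (mem_image.2 ⟨a, mem_erase.2 ⟨hab, ha.1⟩, e.symm⟩)
  have hsum := sum_le_sum hstep
  rw [sum_add_distrib] at hsum
  rw [← add_sum_erase s _ hj]
  lia

/-- Twice the signed area of the triangle `a b c`. -/
def orientedArea (a b c : ℂ) : ℝ :=
  (b.re - a.re) * (c.im - a.im) - (b.im - a.im) * (c.re - a.re)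

/-- No preconnected subset of `Q` contains both `p` and `q`. -/
def SeparatedIn (Q : Set ℂ) (p q : ℂ) : Prop :=
  ∀ s ⊆ Q, IsPreconnected s → p ∈ s → q ∈ s → False

lemma SeparatedIn.symm {Q : Set ℂ} {p q : ℂ} (h : SeparatedIn Q p q) : SeparatedIn Q q p :=
  fun s hs hc hq hp => h s hs hc hp hq

lemma SeparatedIn.ne {Q : Set ℂ} {p q : ℂ} (h : SeparatedIn Q p q) (hp : p ∈ Q) : p ≠ q := by
  rintro rfl
  exact h {p} (singleton_subset_iff.2 hp) isPreconnected_singleton rfl rfl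

lemma Convex.exists_support_of_mem_frontier {V : Set ℂ} (hV : Convex ℝ V)
    (hVi : (interior V).Nonempty) {z : ℂ} (hz : z ∈ frontier V) :
    ∃ f : ℂ →L[ℝ] ℝ, (∀ x ∈ interior V, f x < f z) ∧ ∀ x ∈ V, f x ≤ f z := by
  obtain ⟨f, hf⟩ := geometric_hahn_banach_open_point hV.interior isOpen_interior
    (x := z) hz.2
  refine ⟨f, hf, fun x hx => ?_⟩
  have hx' : x ∈ closure (interior V) := by
    rw [hV.closure_interior_eq_closure_of_nonempty_interior hVi]
    exact subset_closure hx
  exact closure_minimal (fun y hy => (hf y hy).le)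
    (isClosed_le f.continuous continuous_const) hx'

lemma Convex.segment_subset_frontier {V : Set ℂ} (hV : Convex ℝ V) (hVc : IsClosed V)
    (hVi : (interior V).Nonempty) {x y z : ℂ} (hx : x ∈ V) (hy : y ∈ V)
    (hz : z ∈ openSegment ℝ x y) (hzf : z ∈ frontier V) : segment ℝ x y ⊆ frontier V := by
  obtain ⟨f, hf, hf'⟩ := hV.exists_support_of_mem_frontier hVi hzf
  obtain ⟨a, b, ha, hb, hab, rfl⟩ := hz
  have hfx := hf' x hx
  have hfy := hf' y hy
  rintro w ⟨c, d, hc, hd, hcd, rfl⟩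
  rw [hVc.frontier_eq]
  refine ⟨hV hx hy hc hd hcd, fun hw => ?_⟩
  have := hf _ hw
  simp only [map_add, map_smul, smul_eq_mul] at this hfx hfy
  have e : f x = f y := by
    obtain rfl : b = 1 - a := by linarith
    nlinarith
  rw [e, ← add_mul, ← add_mul, hab, hcd] at this
  exact lt_irrefl _ this

lemma Convex.frontier_not_in_open_triangle {V : Set ℂ} (hV : Convex ℝ V)
    (hVi : (interior V).Nonempty) {a b c z : ℂ} (ha : a ∈ V) (hb : b ∈ V) (hc : c ∈ V)
    (hz : z ∈ frontier V) (h₁ : 0 < orientedArea a b z) (h₂ : 0 < orientedArea b c z)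
    (h₃ : 0 < orientedArea c a z) : False := by
  obtain ⟨f, hf, hf'⟩ := hV.exists_support_of_mem_frontier hVi hz
  obtain ⟨w, hw⟩ := hVi
  have hfw := hf w hw
  have hfa := hf' a ha
  have hfb := hf' b hb
  have hfc := hf' c hc
  have key : ∀ x : ℂ, f x = x.re * f 1 + x.im * f Complex.I := by
    intro x
    conv_lhs => rw [← Complex.re_add_im x]
    have : (x.re : ℂ) + x.im * Complex.I = x.re • (1 : ℂ) + x.im • Complex.I := by simp
    rw [this, map_add, map_smul, map_smul, smul_eq_mul, smul_eq_mul]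
  have hsum : orientedArea b c z * (f z - f a) + orientedArea c a z * (f z - f b)
      + orientedArea a b z * (f z - f c) = 0 := by
    simp only [key a, key b, key c, key z, orientedArea]
    ring
  have ea : f z - f a = 0 := by
    have := mul_nonneg h₃.le (sub_nonneg.2 hfb)
    have := mul_nonneg h₁.le (sub_nonneg.2 hfc)
    nlinarith
  have eb : f z - f b = 0 := by
    have := mul_nonneg h₂.le (sub_nonneg.2 hfa)
    have := mul_nonneg h₁.le (sub_nonneg.2 hfc)
    nlinarith
  have hprod : orientedArea a b z * (f z - f w) = 0 := by
    rw [key a, key z] at ea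
    rw [key b, key z] at eb
    rw [key w, key z]
    simp only [orientedArea]
    linear_combination
      ((a.re - z.re) * (w.im - z.im) - (a.im - z.im) * (w.re - z.re)) * eb
      - ((b.re - z.re) * (w.im - z.im) - (b.im - z.im) * (w.re - z.re)) * ea
  rcases mul_eq_zero.1 hprod with h | h <;> linarith

section Body

variable {V U : Set ℂ} {p q r x : ℂ}

lemma SeparatedIn.mem_segment (hV : Convex ℝ V) (hVc : IsClosed V)
    (hVi : (interior V).Nonempty) (hU : Convex ℝ U) (hUV : U ⊆ V)
    (hp : p ∈ U ∩ frontier V) (hq : q ∈ U ∩ frontier V)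
    (h : SeparatedIn (U ∩ frontier V) p q) (hx : x ∈ V) (ha : orientedArea p q x = 0) :
    x ∈ segment ℝ p q := by
  have hne := h.ne hp
  have hpos : 0 < (q.re - p.re) ^ 2 + (q.im - p.im) ^ 2 := by
    by_contra hcon
    have h1 : q.re - p.re = 0 := by nlinarith [sq_nonneg (q.re - p.re), sq_nonneg (q.im - p.im)]
    have h2 : q.im - p.im = 0 := by nlinarith [sq_nonneg (q.re - p.re), sq_nonneg (q.im - p.im)]
    exact hne (Complex.ext (by linarith) (by linarith))
  obtain ⟨t, ht⟩ : ∃ t : ℝ, x = p + t • (q - p) := by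
    refine ⟨((x.re - p.re) * (q.re - p.re) + (x.im - p.im) * (q.im - p.im)) /
      ((q.re - p.re) ^ 2 + (q.im - p.im) ^ 2), ?_⟩
    unfold orientedArea at ha
    apply Complex.ext <;> simp only [Complex.add_re, Complex.add_im, Complex.sub_re,
      Complex.sub_im, Complex.smul_re, Complex.smul_im, smul_eq_mul] <;> field_simp
    · linear_combination -(q.im - p.im) * ha
    · linear_combination (q.re - p.re) * ha
  have hcon : ¬ segment ℝ p q ⊆ frontier V := fun hs =>
    h (segment ℝ p q) (fun w hw => ⟨hU.segment_subset hp.1 hq.1 hw, hs hw⟩)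
      (convex_segment p q).isPreconnected (left_mem_segment ℝ p q) (right_mem_segment ℝ p q)
  by_cases h0 : t < 0
  · refine absurd ?_ hcon
    have hps : p ∈ openSegment ℝ x q := by
      refine ⟨1 / (1 - t), -t / (1 - t), div_pos one_pos (by linarith),
        div_pos (by linarith) (by linarith), ?_, ?_⟩
      · have : 1 - t ≠ 0 := by linarith
        field_simp
        ring
      · have : 1 - t ≠ 0 := by linarith
        rw [ht]
        apply Complex.ext <;> simp only [Complex.add_re, Complex.add_im, Complex.sub_re,
          Complex.sub_im, Complex.smul_re, Complex.smul_im, smul_eq_mul] <;> field_simp <;> ring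
    exact ((convex_segment x q).segment_subset (openSegment_subset_segment _ _ _ hps)
      (right_mem_segment ℝ x q)).trans
      (hV.segment_subset_frontier hVc hVi hx (hUV hq.1) hps hp.2)
  by_cases h1 : 1 < t
  · refine absurd ?_ hcon
    have hqs : q ∈ openSegment ℝ p x := by
      have : t ≠ 0 := by linarith
      refine ⟨(t - 1) / t, 1 / t, div_pos (by linarith) (by linarith),
        div_pos one_pos (by linarith), ?_, ?_⟩
      · field_simp
        ring
      · rw [ht]
        apply Complex.ext <;> simp only [Complex.add_re, Complex.add_im, Complex.sub_re,
          Complex.sub_im, Complex.smul_re, Complex.smul_im, smul_eq_mul] <;> field_simp <;> ring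
    exact ((convex_segment p x).segment_subset (left_mem_segment ℝ p x)
      (openSegment_subset_segment _ _ _ hqs)).trans
      (hV.segment_subset_frontier hVc hVi (hUV hp.1) hx hqs hq.2)
  · rw [segment_eq_image']
    exact ⟨t, ⟨not_lt.1 h0, not_lt.1 h1⟩, ht.symm⟩

lemma SeparatedIn.mem_interior (hV : Convex ℝ V) (hVc : IsClosed V)
    (hVi : (interior V).Nonempty) (hU : Convex ℝ U) (hUV : U ⊆ V)
    (hp : p ∈ U ∩ frontier V) (hq : q ∈ U ∩ frontier V)
    (h : SeparatedIn (U ∩ frontier V) p q) (hx : x ∈ openSegment ℝ p q) : x ∈ interior V := by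
  by_contra hxi
  have hxV : x ∈ V := hV.openSegment_subset (hUV hp.1) (hUV hq.1) hx
  have hs := hV.segment_subset_frontier hVc hVi (hUV hp.1) (hUV hq.1) hx
    (by rw [hVc.frontier_eq]; exact ⟨hxV, hxi⟩)
  exact h (segment ℝ p q) (fun w hw => ⟨hU.segment_subset hp.1 hq.1 hw, hs hw⟩)
      (convex_segment p q).isPreconnected (left_mem_segment ℝ p q) (right_mem_segment ℝ p q)

lemma SeparatedIn.orientedArea_ne_zero (hV : Convex ℝ V) (hVc : IsClosed V)
    (hVi : (interior V).Nonempty) (hU : Convex ℝ U) (hUV : U ⊆ V)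
    (hp : p ∈ U ∩ frontier V) (hq : q ∈ U ∩ frontier V) (hr : r ∈ frontier V)
    (h : SeparatedIn (U ∩ frontier V) p q) (hrp : r ≠ p) (hrq : r ≠ q) :
    orientedArea p q r ≠ 0 := by
  intro h0
  have hrs := h.mem_segment hV hVc hVi hU hUV hp hq (hVc.frontier_subset hr) h0
  exact hr.2 (h.mem_interior hV hVc hVi hU hUV hp hq
    (mem_openSegment_of_ne_left_right hrp.symm hrq.symm hrs))

open Classical in
lemma card_filter_orientedArea_add_one_le (hV : Convex ℝ V) (hVc : IsClosed V)
    (hVi : (interior V).Nonempty) (hU : Convex ℝ U) (hUV : U ⊆ V)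
    (𝓒 : Finset (Set ℂ)) (hne : ∀ C ∈ 𝓒, C.Nonempty) (hsub : ∀ C ∈ 𝓒, C ⊆ V)
    (hside : ∀ p ∈ U ∩ frontier V, ∀ q ∈ U ∩ frontier V, SeparatedIn (U ∩ frontier V) p q →
      ∃ C ∈ 𝓒, C ⊆ {x | 0 < orientedArea p q x})
    (P : Finset ℂ) (hPQ : ∀ p ∈ P, p ∈ U ∩ frontier V)
    (hP : ∀ p ∈ P, ∀ q ∈ P, p ≠ q → SeparatedIn (U ∩ frontier V) p q)
    (hp : p ∈ P) (hq : q ∈ P) (hpq : p ≠ q) :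
    (P.filter fun a => 0 < orientedArea p q a).card + 1 ≤
      (𝓒.filter fun C => C ⊆ {x | 0 < orientedArea p q x}).card := by
  induction hk : (P.filter fun a => 0 < orientedArea p q a).card using Nat.strong_induction_on
    generalizing p q with
  | _ k ih =>
  subst hk
  have hPV : ∀ a ∈ P, a ∈ V := fun a ha => hUV (hPQ a ha).1
  have hPF : ∀ a ∈ P, a ∈ frontier V := fun a ha => (hPQ a ha).2
  rcases (P.filter fun a => 0 < orientedArea p q a).eq_empty_or_nonempty with hA | ⟨r, hrA⟩
  · obtain ⟨C, hC, hCs⟩ := hside p (hPQ p hp) q (hPQ q hq) (hP p hp q hq hpq)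
    rw [hA, Finset.card_empty, zero_add]
    exact Finset.card_pos.2 ⟨C, Finset.mem_filter.2 ⟨hC, hCs⟩⟩
  obtain ⟨hr, hra⟩ := Finset.mem_filter.1 hrA
  have hrp : r ≠ p := by rintro rfl; simp [orientedArea] at hra
  have hrq : r ≠ q := by
    rintro rfl
    refine absurd hra (not_lt.2 (le_of_eq ?_))
    unfold orientedArea
    ring
  have hsep := hP p hp q hq hpq
  have hside₁ : ∀ x ∈ V, 0 < orientedArea p r x → 0 < orientedArea p q x := by
    intro x hx hpx
    by_contra hcon
    rcases (not_lt.1 hcon).eq_or_lt with h0 | hlt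
    · have hxs := hsep.mem_segment hV hVc hVi hU hUV (hPQ p hp) (hPQ q hq) hx h0
      rw [segment_eq_image'] at hxs
      obtain ⟨t, ⟨ht, -⟩, rfl⟩ := hxs
      simp [orientedArea] at hpx hra
      nlinarith
    · refine hV.frontier_not_in_open_triangle hVi hx (hPV q hq) (hPV r hr) (hPF p hp) ?_ ?_ ?_ <;>
      · unfold orientedArea at *
        linarith
  have hside₂ : ∀ x ∈ V, 0 < orientedArea r q x → 0 < orientedArea p q x := by
    intro x hx hpx
    by_contra hcon
    rcases (not_lt.1 hcon).eq_or_lt with h0 | hlt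
    · have hxs := hsep.mem_segment hV hVc hVi hU hUV (hPQ p hp) (hPQ q hq) hx h0
      rw [segment_eq_image'] at hxs
      obtain ⟨t, ⟨-, ht⟩, rfl⟩ := hxs
      simp [orientedArea] at hpx hra
      nlinarith
    · refine hV.frontier_not_in_open_triangle hVi (hPV r hr) (hPV p hp) hx (hPF q hq) ?_ ?_ ?_ <;>
      · unfold orientedArea at *
        linarith
  have hdisj : ∀ x ∈ V, 0 < orientedArea p r x → 0 < orientedArea r q x → False := by
    intro x hx h1 h2
    refine hV.frontier_not_in_open_triangle hVi (hPV p hp) (hPV q hq) hx (hPF r hr) hra ?_ ?_ <;>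
    · unfold orientedArea at *
      linarith
  have hcover : (P.filter fun a => 0 < orientedArea p q a) ⊆
      insert r ((P.filter fun a => 0 < orientedArea p r a) ∪
        (P.filter fun a => 0 < orientedArea r q a)) := by
    intro a ha
    obtain ⟨haP, haa⟩ := Finset.mem_filter.1 ha
    by_contra hcon
    simp only [Finset.mem_insert, Finset.mem_union, Finset.mem_filter, haP, true_and,
      not_or, not_lt] at hcon
    obtain ⟨har, h1, h2⟩ := hcon
    have hap : a ≠ p := by rintro rfl; simp [orientedArea] at haa
    have haq : a ≠ q := by
      rintro rfl
      refine absurd haa (not_lt.2 (le_of_eq ?_))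
      unfold orientedArea
      ring
    have h1' := lt_of_le_of_ne h1 ((hP p hp r hr hrp.symm).orientedArea_ne_zero hV hVc hVi hU hUV
      (hPQ p hp) (hPQ r hr) (hPF a haP) hap har)
    have h2' := lt_of_le_of_ne h2 ((hP r hr q hq hrq).orientedArea_ne_zero hV hVc hVi hU hUV
      (hPQ r hr) (hPQ q hq) (hPF a haP) har haq)
    refine hV.frontier_not_in_open_triangle hVi (hPV p hp) (hPV q hq) (hPV r hr) (hPF a haP) haa
      ?_ ?_ <;>
    · unfold orientedArea at *
      linarith
  have hlt₁ : (P.filter fun a => 0 < orientedArea p r a).card <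
      (P.filter fun a => 0 < orientedArea p q a).card := by
    refine Finset.card_lt_card ((Finset.ssubset_iff_of_subset fun a ha => ?_).2 ⟨r, hrA, ?_⟩)
    · rw [Finset.mem_filter] at ha ⊢
      exact ⟨ha.1, hside₁ a (hPV a ha.1) ha.2⟩
    · simp [orientedArea, mul_comm]
  have hlt₂ : (P.filter fun a => 0 < orientedArea r q a).card <
      (P.filter fun a => 0 < orientedArea p q a).card := by
    refine Finset.card_lt_card ((Finset.ssubset_iff_of_subset fun a ha => ?_).2 ⟨r, hrA, ?_⟩)
    · rw [Finset.mem_filter] at ha ⊢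
      exact ⟨ha.1, hside₂ a (hPV a ha.1) ha.2⟩
    · simp [orientedArea]
  have ih₁ := ih _ hlt₁ hp hr hrp.symm rfl
  have ih₂ := ih _ hlt₂ hr hq hrq rfl
  have hcard := (Finset.card_le_card hcover).trans
    ((Finset.card_insert_le _ _).trans (Nat.succ_le_succ (Finset.card_union_le _ _)))
  have hclasses : (𝓒.filter fun C => C ⊆ {x | 0 < orientedArea p r x}).card +
      (𝓒.filter fun C => C ⊆ {x | 0 < orientedArea r q x}).card ≤
      (𝓒.filter fun C => C ⊆ {x | 0 < orientedArea p q x}).card := by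
    rw [← Finset.card_union_of_disjoint]
    · refine Finset.card_le_card fun C hC => ?_
      rw [Finset.mem_union, Finset.mem_filter, Finset.mem_filter] at hC
      rw [Finset.mem_filter]
      rcases hC with hC | hC
      · exact ⟨hC.1, fun x hx => hside₁ x (hsub C hC.1 hx) (hC.2 hx)⟩
      · exact ⟨hC.1, fun x hx => hside₂ x (hsub C hC.1 hx) (hC.2 hx)⟩
    · refine Finset.disjoint_left.2 fun C hC hC' => ?_
      rw [Finset.mem_filter] at hC hC'
      obtain ⟨x, hx⟩ := hne C hC.1
      exact hdisj x (hsub C hC.1 hx) (hC.2 hx) (hC'.2 hx)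
  lia

lemma card_le_card_of_pairwise_separatedIn (hV : Convex ℝ V) (hVc : IsClosed V)
    (hVi : (interior V).Nonempty) (hU : Convex ℝ U) (hUV : U ⊆ V)
    (𝓒 : Finset (Set ℂ)) (h𝓒 : 𝓒.Nonempty)
    (hne : ∀ C ∈ 𝓒, C.Nonempty) (hsub : ∀ C ∈ 𝓒, C ⊆ V)
    (hside : ∀ p ∈ U ∩ frontier V, ∀ q ∈ U ∩ frontier V, SeparatedIn (U ∩ frontier V) p q →
      ∃ C ∈ 𝓒, C ⊆ {x | 0 < orientedArea p q x})
    (P : Finset ℂ) (hPQ : ∀ p ∈ P, p ∈ U ∩ frontier V)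
    (hP : ∀ p ∈ P, ∀ q ∈ P, p ≠ q → SeparatedIn (U ∩ frontier V) p q) :
    P.card ≤ 𝓒.card := by
  classical
  rcases le_or_gt P.card 1 with h1 | h1
  · exact h1.trans (Finset.card_pos.2 h𝓒)
  obtain ⟨p, hp, q, hq, hpq⟩ := Finset.one_lt_card.1 h1
  have hl := card_filter_orientedArea_add_one_le hV hVc hVi hU hUV 𝓒 hne hsub hside P hPQ hP
    hp hq hpq
  have hr := card_filter_orientedArea_add_one_le hV hVc hVi hU hUV 𝓒 hne hsub hside P hPQ hP
    hq hp hpq.symm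
  have hflip : ∀ x, orientedArea q p x = -orientedArea p q x := fun x => by
    unfold orientedArea
    ring
  have hcover : P ⊆ insert p (insert q ((P.filter fun a => 0 < orientedArea p q a) ∪
      (P.filter fun a => 0 < orientedArea q p a))) := by
    intro a ha
    by_contra hcon
    simp only [Finset.mem_insert, Finset.mem_union, Finset.mem_filter, ha, true_and,
      not_or, not_lt, hflip, neg_nonpos] at hcon
    obtain ⟨hap, haq, h1, h2⟩ := hcon
    exact (hP p hp q hq hpq).orientedArea_ne_zero hV hVc hVi hU hUV
      (hPQ p hp) (hPQ q hq) (hPQ a ha).2 hap haq (le_antisymm h1 h2)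
  have hcard := Finset.card_le_card hcover
  have h2 := Finset.card_insert_le p (insert q ((P.filter fun a => 0 < orientedArea p q a) ∪
      (P.filter fun a => 0 < orientedArea q p a)))
  have h3 := Finset.card_insert_le q ((P.filter fun a => 0 < orientedArea p q a) ∪
      (P.filter fun a => 0 < orientedArea q p a))
  have h4 := Finset.card_union_le (P.filter fun a => 0 < orientedArea p q a)
      (P.filter fun a => 0 < orientedArea q p a)
  have hclasses : (𝓒.filter fun C => C ⊆ {x | 0 < orientedArea p q x}).card +
      (𝓒.filter fun C => C ⊆ {x | 0 < orientedArea q p x}).card ≤ 𝓒.card := by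
    rw [← Finset.card_union_of_disjoint]
    · exact Finset.card_le_card (Finset.union_subset (Finset.filter_subset _ _)
        (Finset.filter_subset _ _))
    · refine Finset.disjoint_left.2 fun C hC hC' => ?_
      rw [Finset.mem_filter] at hC hC'
      obtain ⟨x, hx⟩ := hne C hC.1
      have h5 : 0 < orientedArea p q x := hC.2 hx
      have h6 : 0 < orientedArea q p x := hC'.2 hx
      rw [hflip] at h6
      linarith
  lia

end Body

lemma IsCompact.convexJoin {E : Type*} [AddCommGroup E] [Module ℝ E] [TopologicalSpace E]
    [IsTopologicalAddGroup E] [ContinuousSMul ℝ E] {s t : Set E} (hs : IsCompact s)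
    (ht : IsCompact t) : IsCompact (_root_.convexJoin ℝ s t) := by
  have himg : _root_.convexJoin ℝ s t =
      (fun z : (E × E) × ℝ => z.1.1 + z.2 • (z.1.2 - z.1.1)) '' ((s ×ˢ t) ×ˢ Icc (0 : ℝ) 1) := by
    ext x
    simp only [mem_convexJoin, segment_eq_image', mem_image, mem_prod, Prod.exists]
    constructor
    · rintro ⟨a, ha, b, hb, θ, hθ, rfl⟩
      exact ⟨a, b, θ, ⟨⟨ha, hb⟩, hθ⟩, rfl⟩
    · rintro ⟨a, b, θ, ⟨⟨ha, hb⟩, hθ⟩, rfl⟩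
      exact ⟨a, ha, b, hb, θ, hθ, rfl⟩
  rw [himg]
  exact ((hs.prod ht).prod isCompact_Icc).image (by fun_prop)

lemma isCompact_convexHull_biUnion {E ι : Type*} [AddCommGroup E] [Module ℝ E]
    [TopologicalSpace E] [IsTopologicalAddGroup E] [ContinuousSMul ℝ E] {U : ι → Set E}
    (hUc : ∀ i, IsCompact (U i)) (hUconv : ∀ i, Convex ℝ (U i)) (s : Finset ι) :
    IsCompact (convexHull ℝ (⋃ i ∈ s, U i)) := by
  classical
  induction s using Finset.induction_on with
  | empty => simp
  | insert a s ha ih =>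
    rw [Finset.set_biUnion_insert]
    rcases (U a).eq_empty_or_nonempty with h0 | h0
    · rwa [h0, empty_union]
    rcases (⋃ i ∈ s, U i).eq_empty_or_nonempty with h1 | h1
    · rw [h1, union_empty, (hUconv a).convexHull_eq]
      exact hUc a
    · rw [convexHull_union h0 h1, (hUconv a).convexHull_eq]
      exact (hUc a).convexJoin ih

lemma orientedArea_combo {p q x y : ℂ} {a b : ℝ} (hab : a + b = 1) :
    orientedArea p q (a • x + b • y) = a * orientedArea p q x + b * orientedArea p q y := by
  obtain rfl : a = 1 - b := by linarith
  simp only [orientedArea, Complex.add_re, Complex.add_im, Complex.smul_re, Complex.smul_im,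
    smul_eq_mul]
  ring

lemma continuous_orientedArea (p q : ℂ) : Continuous (orientedArea p q) := by
  unfold orientedArea
  fun_prop

lemma convex_orientedArea_nonpos (p q : ℂ) : Convex ℝ {x | orientedArea p q x ≤ 0} := by
  intro x hx y hy a b ha hb hab
  rw [mem_ofPred_eq] at *
  rw [orientedArea_combo hab]
  nlinarith

/-- The part of the frontier of a planar convex body on one side of a line meeting its interior
is connected. -/
lemma Convex.isPreconnected_frontier_inter_halfPlane {V : Set ℂ} (hV : Convex ℝ V)
    (hVc : IsCompact V) {p q m : ℂ} (hpq : p ≠ q) (hm : m ∈ interior V)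
    (hma : orientedArea p q m = 0) :
    IsPreconnected (frontier V ∩ {x | 0 ≤ orientedArea p q x}) := by
  set W : Set ℂ := (fun x => m + x) ⁻¹' V with hW
  have hWeq : W = (Homeomorph.addLeft m) ⁻¹' V := rfl
  have hWconv : Convex ℝ W := hV.translate_preimage_right m
  have hW0 : W ∈ nhds (0 : ℂ) := by
    refine (Homeomorph.addLeft m).continuous.continuousAt.preimage_mem_nhds ?_
    simpa using mem_interior_iff_mem_nhds.1 hm
  have hWb : Bornology.IsVonNBounded ℝ W := by
    have : IsCompact W := by
      rw [hWeq]
      exact (Homeomorph.addLeft m).isCompact_preimage.2 hVc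
    exact this.isVonNBounded ℝ
  have hfront : ∀ x, gauge W x = 1 ↔ m + x ∈ frontier V := by
    intro x
    rw [gauge_eq_one_iff_mem_frontier hWconv hW0, hWeq, ← Homeomorph.preimage_frontier]
    rfl
  have hpos : ∀ x : ℂ, x ≠ 0 → 0 < gauge W x := fun x hx =>
    (gauge_pos (absorbent_nhds_zero hW0) hWb).2 hx
  set g : ℂ → ℝ := fun x => (q.re - p.re) * x.im - (q.im - p.im) * x.re with hg
  have hga : ∀ (c : ℝ) (x : ℂ), orientedArea p q (m + c • x) = c * g x := by
    intro c x
    rw [hg]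
    unfold orientedArea at hma ⊢
    simp only [Complex.add_re, Complex.add_im, Complex.smul_re, Complex.smul_im, smul_eq_mul]
    linear_combination hma
  set H : Set ℂ := {x | x ≠ 0 ∧ 0 ≤ g x} with hH
  set e : ℂ := ⟨-(q.im - p.im), q.re - p.re⟩ with he
  have hge : 0 < g e := by
    have : g e = (q.re - p.re) ^ 2 + (q.im - p.im) ^ 2 := by
      simp only [hg, he]
      ring
    rw [this]
    by_contra hcon
    have h1 : q.re - p.re = 0 := by nlinarith [sq_nonneg (q.re - p.re), sq_nonneg (q.im - p.im)]
    have h2 : q.im - p.im = 0 := by nlinarith [sq_nonneg (q.re - p.re), sq_nonneg (q.im - p.im)]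
    exact hpq (Complex.ext (by linarith) (by linarith))
  have he0 : e ≠ 0 := by
    intro h0
    rw [h0] at hge
    simp [hg] at hge
  have hstar : StarConvex ℝ e H := by
    rintro x ⟨hx0, hx⟩ a b ha hb hab
    have hlin : g (a • e + b • x) = a * g e + b * g x := by
      simp only [hg, Complex.add_re, Complex.add_im, Complex.smul_re, Complex.smul_im, smul_eq_mul]
      ring
    refine ⟨fun h0 => ?_, ?_⟩
    · rw [h0] at hlin
      have : g 0 = 0 := by simp [hg]
      have h1 := mul_nonneg hb hx
      have ha0 : a = 0 := by
        by_contra hane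
        have := mul_pos (lt_of_le_of_ne ha (Ne.symm hane)) hge
        linarith
      obtain rfl : b = 1 := by linarith
      simp [ha0, hx0] at h0
    · rw [hlin]
      positivity
  have hHc : IsPreconnected H :=
    (hstar.isPathConnected (show e ∈ H from ⟨he0, hge.le⟩)).isConnected.isPreconnected
  have himg : frontier V ∩ {x | 0 ≤ orientedArea p q x} =
      (fun x => m + (gauge W x)⁻¹ • x) '' H := by
    ext y
    constructor
    · rintro ⟨hy, hya⟩
      have hy1 : gauge W (y - m) = 1 := (hfront _).2 (by simpa using hy)
      refine ⟨y - m, ⟨fun h0 => ?_, ?_⟩, by simp [hy1]⟩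
      · rw [h0, gauge_zero] at hy1
        exact zero_ne_one hy1
      · have := hga 1 (y - m)
        rw [one_smul, add_sub_cancel, one_mul] at this
        rw [← this]
        exact hya
    · rintro ⟨x, ⟨hx0, hx⟩, rfl⟩
      have hgp := hpos x hx0
      refine ⟨(hfront _).1 ?_, ?_⟩
      · rw [gauge_smul_of_nonneg (inv_nonneg.2 hgp.le), smul_eq_mul, inv_mul_cancel₀ hgp.ne']
      · rw [mem_ofPred_eq, hga]
        positivity
  rw [himg]
  refine hHc.image _ ?_
  refine continuousOn_const.add (ContinuousOn.fun_smul (ContinuousOn.inv₀ ?_ ?_) continuousOn_id)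
  · exact (continuous_gauge hWconv hW0).continuousOn
  · exact fun x hx => (hpos x hx.1).ne'

lemma SeparatedIn.not_subset {V U : Set ℂ} {p q : ℂ} (hV : Convex ℝ V) (hVc : IsCompact V)
    (hVi : (interior V).Nonempty) (hU : Convex ℝ U) (hUV : U ⊆ V)
    (hp : p ∈ U ∩ frontier V) (hq : q ∈ U ∩ frontier V)
    (h : SeparatedIn (U ∩ frontier V) p q) : ¬ V ∩ {x | 0 < orientedArea p q x} ⊆ U := by
  intro hcon
  have hm : midpoint ℝ p q ∈ openSegment ℝ p q := by
    refine ⟨1 / 2, 1 / 2, by norm_num, by norm_num, by norm_num, ?_⟩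
    rw [midpoint_eq_smul_add]
    simp [smul_add]
  have hmi := h.mem_interior hV hVc.isClosed hVi hU hUV hp hq hm
  have hp0 : orientedArea p q p = 0 := by simp [orientedArea]
  have hq0 : orientedArea p q q = 0 := by
    unfold orientedArea
    ring
  have hma : orientedArea p q (midpoint ℝ p q) = 0 := by
    obtain ⟨a, b, -, -, hab, e⟩ := hm
    rw [← e, orientedArea_combo hab, hp0, hq0]
    simp
  refine h _ ?_ (hV.isPreconnected_frontier_inter_halfPlane hVc (h.ne hp) hmi hma)
    ⟨hp.2, hp0.ge⟩ ⟨hq.2, hq0.ge⟩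
  rintro x ⟨hxf, hxa⟩
  have hxV := hVc.isClosed.frontier_subset hxf
  refine ⟨?_, hxf⟩
  rcases (show 0 ≤ orientedArea p q x from hxa).eq_or_lt with h0 | hlt
  · exact hU.segment_subset hp.1 hq.1
      (h.mem_segment hV hVc.isClosed hVi hU hUV hp hq hxV h0.symm)
  · exact hcon ⟨hxV, hlt⟩

lemma SeparatedIn.exists_interior_pos {ι : Type*} {U : ι → Set ℂ} {V : Set ℂ} {i : ι} {p q : ℂ}
    (hUc : ∀ j, IsClosed (U j)) (hUconv : ∀ j, Convex ℝ (U j))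
    (hUint : ∀ j, (interior (U j)).Nonempty) (hV : V = convexHull ℝ (⋃ j, U j))
    (hVc : IsCompact V) (hp : p ∈ U i ∩ frontier V) (hq : q ∈ U i ∩ frontier V)
    (h : SeparatedIn (U i ∩ frontier V) p q) :
    ∃ j ≠ i, ∃ x ∈ interior (U j), 0 < orientedArea p q x := by
  have hVconv : Convex ℝ V := hV ▸ convex_convexHull ℝ _
  have hUV : ∀ j, U j ⊆ V := fun j =>
    (subset_iUnion U j).trans (hV ▸ subset_convexHull ℝ _)
  have hVi : (interior V).Nonempty := (hUint i).mono (interior_mono (hUV i))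
  by_contra! hcon
  have hneg : ∀ j ≠ i, U j ⊆ V ∩ {x | orientedArea p q x ≤ 0} := by
    refine fun j hj => subset_inter (hUV j) ?_
    rw [← (hUc j).closure_eq,
      ← (hUconv j).closure_interior_eq_closure_of_nonempty_interior (hUint j)]
    exact closure_minimal (hcon j hj)
      (isClosed_le (continuous_orientedArea p q) continuous_const)
  have hp0 : orientedArea p q p = 0 := by simp [orientedArea]
  have hjoin : V ⊆ convexJoin ℝ (U i) (V ∩ {x | orientedArea p q x ≤ 0}) := by
    have hsub : convexHull ℝ (⋃ j, U j) ⊆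
        convexJoin ℝ (U i) (V ∩ {x | orientedArea p q x ≤ 0}) := by
      refine convexHull_min (iUnion_subset fun j => ?_)
        ((hUconv i).convexJoin (hVconv.inter (convex_orientedArea_nonpos p q)))
      by_cases hj : j = i
      · rw [hj]
        exact subset_convexJoin_left ⟨p, hUV i hp.1, hp0.le⟩
      · exact (hneg j hj).trans (subset_convexJoin_right ⟨p, hp.1⟩)
    rwa [← hV] at hsub
  refine h.not_subset hVconv hVc hVi (hUconv i) (hUV i) hp hq ?_
  rintro v ⟨hv, hva⟩
  obtain ⟨x, hx, y, ⟨hyV, hya⟩, a, b, ha, hb, hab, rfl⟩ := mem_convexJoin.1 (hjoin hv)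
  rw [mem_ofPred_eq, orientedArea_combo hab] at hva
  rw [mem_ofPred_eq] at hya
  set α := orientedArea p q x with hα
  set β := orientedArea p q y with hβ
  have hαpos : 0 < α := by
    by_contra hle
    nlinarith [mul_nonneg ha (neg_nonneg.2 (not_lt.1 hle)), mul_nonneg hb (neg_nonneg.2 hya)]
  have hden : 0 < α - β := by linarith
  set c : ℂ := (-β / (α - β)) • x + (α / (α - β)) • y with hc
  have hsum : -β / (α - β) + α / (α - β) = 1 := by
    field_simp
    ring
  have hcV : c ∈ V := hVconv (hUV i hx) hyV (div_nonneg (by linarith) hden.le)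
    (div_nonneg hαpos.le hden.le) hsum
  have hc0 : orientedArea p q c = 0 := by
    rw [hc, orientedArea_combo hsum, ← hα, ← hβ]
    field_simp
    ring
  have hcU : c ∈ U i := (hUconv i).segment_subset hp.1 hq.1
    (h.mem_segment hVconv hVc.isClosed hVi (hUconv i) (hUV i) hp hq hcV hc0)
  have hv' : a • x + b • y = ((a * α + b * β) / α) • x + (b * (α - β) / α) • c := by
    rw [hc]
    obtain rfl : a = 1 - b := by linarith
    apply Complex.ext <;> simp only [Complex.add_re, Complex.add_im, Complex.smul_re,
      Complex.smul_im, smul_eq_mul] <;> field_simp <;> ring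
  rw [hv']
  refine (hUconv i) hx hcU (div_nonneg hva.le hαpos.le)
    (div_nonneg (mul_nonneg hb hden.le) hαpos.le) ?_
  obtain rfl : a = 1 - b := by linarith
  field_simp
  ring

lemma IsPreconnected.connectedComponentIn_eq_of_mem {X : Type*} [TopologicalSpace X] {s F : Set X}
    {x y : X} (hs : IsPreconnected s) (hsF : s ⊆ F) (hx : x ∈ s) (hy : y ∈ s) :
    _root_.connectedComponentIn F x = _root_.connectedComponentIn F y :=
  connectedComponentIn_eq (hs.subset_connectedComponentIn hx hsF hy)

lemma Convex.disjoint_interior_left {A B : Set ℂ} (hB : Convex ℝ B) (hBi : (interior B).Nonempty)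
    (h : Disjoint (interior A) (interior B)) : Disjoint (interior A) B := by
  refine (h.closure_right isOpen_interior).mono_right ?_
  rw [hB.closure_interior_eq_closure_of_nonempty_interior hBi]
  exact subset_closure

lemma IsOpen.exists_mem_apply_ne {O : Set ℂ} (hO : IsOpen O) {w : ℂ} (hw : w ∈ O)
    (f : ℂ →L[ℝ] ℝ) (hf : f ≠ 0) (t : ℝ) : ∃ y ∈ O, f y ≠ t := by
  by_contra! hcon
  refine hf ?_
  have hev : (fun x => f x) =ᶠ[nhds w] fun _ => t :=
    Filter.eventually_of_mem (hO.mem_nhds hw) hcon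
  exact (f.hasFDerivAt.congr_of_eventuallyEq hev.symm).unique (hasFDerivAt_const t w)

lemma connectedComponentIn_diff_eq_or {V A B O : Set ℂ} {a b c : ℂ} (hV : Convex ℝ V)
    (hA : Convex ℝ A) (hB : Convex ℝ B) (hAV : A ⊆ V) (hBV : B ⊆ V) (hO : Convex ℝ O)
    (hOo : IsOpen O) (hOV : O ⊆ V) (hAB : Disjoint (interior A) (interior B))
    (hOA : Disjoint O A) (hOB : Disjoint O B) (ha : a ∈ interior A) (hb : b ∈ interior B)
    (hc : c ∈ O) :
    connectedComponentIn (V \ A) c = connectedComponentIn (V \ A) b ∨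
      connectedComponentIn (V \ B) c = connectedComponentIn (V \ B) a := by
  obtain ⟨f, t, hfA, hfB⟩ := geometric_hahn_banach_open_open hA.interior isOpen_interior
    hB.interior isOpen_interior hAB
  have hf0 : f ≠ 0 := by
    rintro rfl
    have h1 := hfA a ha
    have h2 := hfB b hb
    simp only [zero_apply] at h1 h2
    linarith
  have hfA' : ∀ x ∈ A, f x ≤ t := fun x hx =>
    closure_minimal (fun y hy => (hfA y hy).le) (isClosed_le f.continuous continuous_const)
      (hA.closure_interior_eq_closure_of_nonempty_interior ⟨a, ha⟩ ▸ subset_closure hx)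
  have hfB' : ∀ x ∈ B, t ≤ f x := fun x hx =>
    closure_minimal (fun y hy => (hfB y hy).le) (isClosed_le continuous_const f.continuous)
      (hB.closure_interior_eq_closure_of_nonempty_interior ⟨b, hb⟩ ▸ subset_closure hx)
  obtain ⟨y, hyO, hyt⟩ := hOo.exists_mem_apply_ne hc f hf0 t
  have hOA' : O ⊆ V \ A := subset_sdiff.2 ⟨hOV, hOA⟩
  have hOB' : O ⊆ V \ B := subset_sdiff.2 ⟨hOV, hOB⟩
  rcases hyt.lt_or_gt with hlt | hgt
  · right
    rw [hO.isPreconnected.connectedComponentIn_eq_of_mem hOB' hc hyO]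
    exact (hV.inter (convex_halfSpace_lt f.isLinear t)).isPreconnected.connectedComponentIn_eq_of_mem
      (fun x hx => ⟨hx.1, fun hxB => absurd hx.2 (not_lt.2 (hfB' x hxB))⟩)
      ⟨hOV hyO, hlt⟩ ⟨hAV (interior_subset ha), hfA a ha⟩
  · left
    rw [hO.isPreconnected.connectedComponentIn_eq_of_mem hOA' hc hyO]
    exact (hV.inter (convex_halfSpace_gt f.isLinear t)).isPreconnected.connectedComponentIn_eq_of_mem
      (fun x hx => ⟨hx.1, fun hxA => absurd hx.2 (not_lt.2 (hfA' x hxA))⟩)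
      ⟨hOV hyO, hgt⟩ ⟨hBV (interior_subset hb), hfB b hb⟩

lemma finite_connectedComponents_and_card_le {Q : Set ℂ} {N : ℕ}
    (h : ∀ P : Finset ℂ, (∀ p ∈ P, p ∈ Q) →
      (∀ p ∈ P, ∀ q ∈ P, p ≠ q → SeparatedIn Q p q) → P.card ≤ N) :
    Finite (ConnectedComponents Q) ∧ Nat.card (ConnectedComponents Q) ≤ N := by
  classical
  set rep : ConnectedComponents Q → ℂ :=
    fun c => ((ConnectedComponents.surjective_coe c).choose : Q) with hrep
  have hrepQ : ∀ c, rep c ∈ Q := fun c => Subtype.coe_prop _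
  have hrepc : ∀ c, ((⟨rep c, hrepQ c⟩ : Q) : ConnectedComponents Q) = c := fun c =>
    (ConnectedComponents.surjective_coe c).choose_spec
  have hinj : Function.Injective rep := by
    intro c d hcd
    rw [← hrepc c, ← hrepc d]
    simp only [hcd]
  have hbound : ∀ T : Finset (ConnectedComponents Q), T.card ≤ N := by
    intro T
    rw [← Finset.card_image_of_injective T hinj]
    refine h _ ?_ ?_
    · simp only [Finset.mem_image]
      rintro _ ⟨c, -, rfl⟩
      exact hrepQ c
    · simp only [Finset.mem_image]
      rintro _ ⟨c, -, rfl⟩ _ ⟨d, -, rfl⟩ hcd s hsQ hs hcs hds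
      refine hcd (congrArg rep ?_)
      have hs' : IsPreconnected (((↑) : Q → ℂ) ⁻¹' s) := by
        refine Topology.IsInducing.subtypeVal.isPreconnected_image.1 ?_
        rwa [Subtype.image_preimage_coe, inter_eq_right.2 hsQ]
      rw [← hrepc c, ← hrepc d]
      exact ConnectedComponents.coe_eq_coe'.2
        (hs'.subset_connectedComponent (x := ⟨rep d, hrepQ d⟩) hds hcs)
  have hfin : Finite (ConnectedComponents Q) := by
    by_contra hinf
    rw [not_finite_iff_infinite] at hinf
    obtain ⟨T, hT⟩ := Infinite.exists_subset_card_eq (ConnectedComponents Q) (N + 1)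
    have := hbound T
    lia
  refine ⟨hfin, ?_⟩
  have := Fintype.ofFinite (ConnectedComponents Q)
  rw [Nat.card_eq_fintype_card]
  exact hbound Finset.univ

/-- Lemma 3: for compact convex sets `U₁,…,Uₙ` (n ≥ 2) with nonempty pairwise disjoint
interiors, with `V` the convex hull of their union and `Qᵢ = Uᵢ ∩ frontier V`,
each `Qᵢ` has finitely many connected components and the total number of components
is at most `2n - 2`. -/
theorem components_on_frontier_of_convexHull
    (n : ℕ) (hn : 2 ≤ n)
    (U : Fin n → Set ℂ)
    (hUc : ∀ i, IsCompact (U i)) (hUconv : ∀ i, Convex ℝ (U i))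
    (hUint : ∀ i, (interior (U i)).Nonempty)
    (hUdisj : ∀ i j, i ≠ j → interior (U i) ∩ interior (U j) = ∅)
    (V : Set ℂ) (hV : V = convexHull ℝ (⋃ i, U i))
    (Q : Fin n → Set ℂ) (hQ : ∀ i, Q i = U i ∩ frontier V) :
    (∀ i, Finite (ConnectedComponents (Q i))) ∧
      ∑ i, Nat.card (ConnectedComponents (Q i)) ≤ 2 * n - 2 := by
  classical
  have hVconv : Convex ℝ V := hV ▸ convex_convexHull ℝ _
  have hUV : ∀ j, U j ⊆ V := fun j =>
    (subset_iUnion U j).trans (hV ▸ subset_convexHull ℝ _)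
  have hVc : IsCompact V := by
    simpa [hV] using isCompact_convexHull_biUnion hUc hUconv Finset.univ
  have hdisj : ∀ i j, i ≠ j → Disjoint (interior (U i)) (interior (U j)) := fun i j hij =>
    disjoint_iff_inter_eq_empty.2 (hUdisj i j hij)
  have hdisj' : ∀ i j, i ≠ j → Disjoint (interior (U i)) (U j) := fun i j hij =>
    (hUconv j).disjoint_interior_left (hUint j) (hdisj i j hij)
  have hintV : ∀ j, interior (U j) ⊆ V := fun j => interior_subset.trans (hUV j)
  have hintd : ∀ i j, j ≠ i → interior (U j) ⊆ V \ U i := fun i j hij =>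
    subset_sdiff.2 ⟨hintV j, hdisj' j i hij⟩
  choose u hu using hUint
  set g : Fin n → Fin n → Set ℂ := fun i j => connectedComponentIn (V \ U i) (u j) with hg
  have hmain : ∀ i, Finite (ConnectedComponents (Q i)) ∧
      Nat.card (ConnectedComponents (Q i)) ≤ ((Finset.univ.erase i).image (g i)).card := by
    intro i
    rw [hQ i]
    refine finite_connectedComponents_and_card_le fun P hPQ hP => ?_
    have hVi : (interior V).Nonempty := ⟨u i, interior_mono (hUV i) (hu i)⟩
    refine card_le_card_of_pairwise_separatedIn hVconv hVc.isClosed hVi (hUconv i) (hUV i) _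
      ?_ ?_ ?_ ?_ P hPQ hP
    · rw [Finset.image_nonempty, ← Finset.card_pos, Finset.card_erase_of_mem (Finset.mem_univ i),
        Finset.card_univ, Fintype.card_fin]
      lia
    · simp only [Finset.mem_image, Finset.mem_erase, Finset.mem_univ, and_true]
      rintro _ ⟨j, hj, rfl⟩
      exact ⟨u j, mem_connectedComponentIn (hintd i j hj (hu j))⟩
    · simp only [Finset.mem_image]
      rintro _ ⟨j, -, rfl⟩
      exact (connectedComponentIn_subset _ _).trans sdiff_subset
    · intro p hp q hq hpq
      obtain ⟨j, hj, x, hx, hxa⟩ := hpq.exists_interior_pos (fun j => (hUc j).isClosed) hUconv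
        (fun j => ⟨u j, hu j⟩) hV hVc hp hq
      refine ⟨g i j, Finset.mem_image_of_mem _ (Finset.mem_erase.2 ⟨hj, Finset.mem_univ j⟩), ?_⟩
      refine IsPreconnected.subset_left_of_subset_union
        (isOpen_lt continuous_const (continuous_orientedArea p q))
        (isOpen_lt (continuous_orientedArea p q) (continuous_const (y := 0))) ?_ ?_ ⟨x, ?_, hxa⟩
        isPreconnected_connectedComponentIn
      · exact disjoint_left.2 fun y hy hy' =>
          lt_asymm (show 0 < orientedArea p q y from hy) hy'
      · intro y hy
        have hyV := connectedComponentIn_subset _ _ hy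
        rcases lt_trichotomy 0 (orientedArea p q y) with h | h | h
        · exact Or.inl h
        · exact absurd ((hUconv i).segment_subset hp.1 hq.1 (hpq.mem_segment hVconv hVc.isClosed
            hVi (hUconv i) (hUV i) hp hq hyV.1 h.symm)) hyV.2
        · exact Or.inr h
      · exact (hUconv j).interior.isPreconnected.subset_connectedComponentIn (hu j)
          (hintd i j hj) hx
  refine ⟨fun i => (hmain i).1, ?_⟩
  have hcount := sum_card_image_erase_le g (fun i j k hij hki hkj =>
    connectedComponentIn_diff_eq_or hVconv (hUconv i) (hUconv j) (hUV i) (hUV j)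
      (hUconv k).interior isOpen_interior (hintV k) (hdisj i j hij) (hdisj' k i hki)
      (hdisj' k j hkj) (hu i) (hu j) (hu k)) Finset.univ ⟨⟨0, by lia⟩, Finset.mem_univ _⟩
  have hsum := Finset.sum_le_sum fun i (_ : i ∈ Finset.univ) => (hmain i).2
  rw [Finset.card_univ, Fintype.card_fin] at hcount
  lia
end

section
/- Suppose n > 2 and the system (φ₁,…,φₙ) satisfies the open convex set condition, with the interior of K̃ = convexHull ℝ K nonempty. For i ≠ j, let Q_{i,s} be a connected component of Qᵢ = φᵢ(K̃) ∩ frontier K̃ and Q_{j,t} a connected component of Qⱼ = φⱼ(K̃) ∩ frontier K̃. Then Q_{i,s} ∩ Q_{j,t} is a subsingleton (empty or a single point). -/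
open Set

/-- Two real functionals on the plane with a common nonzero kernel vector are proportional. -/
lemma Complex.dual_mul_comm_of_apply_eq_zero (f g : ℂ →L[ℝ] ℝ) {d : ℂ} (hd : d ≠ 0)
    (hf : f d = 0) (hg : g d = 0) (z w : ℂ) : f z * g w = f w * g z := by
  have expand : ∀ (h : ℂ →L[ℝ] ℝ) (z : ℂ), h z = z.re * h 1 + z.im * h Complex.I := by
    intro h z
    have hz : z = z.re • (1 : ℂ) + z.im • Complex.I := by
      apply Complex.ext <;> simp
    conv_lhs => rw [hz]
    rw [map_add, map_smul, map_smul, smul_eq_mul, smul_eq_mul]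
  have hdet : f 1 * g Complex.I = f Complex.I * g 1 := by
    rw [expand] at hf hg
    by_cases hre : d.re = 0
    · have him : d.im ≠ 0 := fun him => hd (Complex.ext hre him)
      apply mul_left_cancel₀ him
      linear_combination f 1 * hg - g 1 * hf
    · apply mul_left_cancel₀ hre
      linear_combination g Complex.I * hf - f Complex.I * hg
  rw [expand f z, expand g w, expand f w, expand g z]
  linear_combination (z.re * w.im - z.im * w.re) * hdet

/-- A connected part of the frontier of `C` joining the endpoints of a chord sees every interior
point of `C` on its side of the chord. -/
lemma mem_of_isPreconnected_of_lt {A C S : Set ℂ} (hC : Convex ℝ C) (hA : Convex ℝ A)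
    (hS : IsPreconnected S) (hSA : S ⊆ A) (hSC : S ⊆ frontier C) {a b : ℂ} (ha : a ∈ S)
    (hb : b ∈ S) (hm : midpoint ℝ a b ∈ interior C) (f : ℂ →L[ℝ] ℝ) {c : ℝ}
    (hfA : ∀ z ∈ A, f z ≤ c) (hfa : f a = c) (hfb : f b = c) {p : ℂ} (hp : p ∈ interior C)
    (hfp : f p < c) : p ∈ A := by
  have hmA : midpoint ℝ a b ∈ A := hA.midpoint_mem (hSA ha) (hSA hb)
  have hfm : f (midpoint ℝ a b) = c := by
    rw [midpoint_eq_smul_add, map_smul, map_add, hfa, hfb]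
    simp only [invOf_eq_inv, smul_eq_mul]; ring
  have hab : a - midpoint ℝ a b = -(b - midpoint ℝ a b) := by
    rw [midpoint_eq_smul_add, invOf_eq_inv, Complex.real_smul]; push_cast; ring
  set m := midpoint ℝ a b
  have hpm : p - m ≠ 0 := by
    intro h
    rw [sub_eq_zero.1 h] at hfp
    exact hfp.ne hfm
  obtain ⟨s, hsS, hs⟩ : ∃ s ∈ S, ((s - m) / (p - m)).im = 0 := by
    have hcont : ContinuousOn (fun z : ℂ => ((z - m) / (p - m)).im) S := by fun_prop
    have hconn := (hS.image _ hcont).ordConnected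
    have h0 : (0 : ℝ) ∈ uIcc ((a - m) / (p - m)).im ((b - m) / (p - m)).im := by
      rw [hab, neg_div, Complex.neg_im, mem_uIcc]
      rcases le_total 0 ((b - m) / (p - m)).im with h | h
      · left; constructor <;> linarith
      · right; constructor <;> linarith
    exact hconn.uIcc_subset (mem_image_of_mem _ ha) (mem_image_of_mem _ hb) h0
  set t := ((s - m) / (p - m)).re
  have hst : s = m + t • (p - m) := by
    have : (s - m) / (p - m) = (t : ℂ) := Complex.ext rfl (by simpa using hs)
    rw [div_eq_iff hpm] at this
    rw [Complex.real_smul, ← this]; ring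
  have hfs : f s = c + t * (f p - c) := by
    rw [hst, map_add, map_smul, map_sub, hfm, smul_eq_mul]
  have ht0 : 0 ≤ t := by
    by_contra! h
    have := hfA s (hSA hsS)
    nlinarith
  have ht1 : 1 < t := by
    by_contra! h
    exact (hSC hsS).2 (hst ▸ hC.interior.add_smul_sub_mem hm hp ⟨ht0, h⟩)
  have hpt : p = m + t⁻¹ • (s - m) := by
    rw [hst, add_sub_cancel_left, smul_smul, inv_mul_cancel₀ (by positivity), one_smul]; ring
  rw [hpt]
  exact hA.add_smul_sub_mem hmA (hSA hsS) ⟨by positivity, inv_le_one_of_one_le₀ ht1.le⟩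

/-- If convex bodies with disjoint interiors inside `C` share two points of connected parts of
their traces on the frontier of `C`, they leave no room for a further open set in `C`. -/
lemma subsingleton_inter_of_disjoint_interior {A B C S T V : Set ℂ} (hC : Convex ℝ C)
    (hA : Convex ℝ A) (hB : Convex ℝ B) (hAC : A ⊆ C) (hBC : B ⊆ C)
    (hAne : (interior A).Nonempty) (hBne : (interior B).Nonempty)
    (hAB : Disjoint (interior A) (interior B)) (hV : IsOpen V) (hVne : V.Nonempty) (hVC : V ⊆ C)
    (hVA : Disjoint V (interior A)) (hVB : Disjoint V (interior B))
    (hS : IsPreconnected S) (hSA : S ⊆ A ∩ frontier C)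
    (hT : IsPreconnected T) (hTB : T ⊆ B ∩ frontier C) : (S ∩ T).Subsingleton := by
  rintro a ⟨haS, haT⟩ b ⟨hbS, hbT⟩
  by_contra hne
  obtain ⟨f, c, hfA, hfB⟩ :=
    geometric_hahn_banach_open_open hA.interior isOpen_interior hB.interior isOpen_interior hAB
  have hcl : ∀ {D : Set ℂ}, Convex ℝ D → (interior D).Nonempty → D ⊆ closure (interior D) :=
    fun hD hDne => by
      rw [hD.closure_interior_eq_closure_of_nonempty_interior hDne]; exact subset_closure
  have hfA' : ∀ z ∈ A, f z ≤ c := fun z hz =>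
    closure_minimal (fun w hw => (hfA w hw).le) (isClosed_le f.continuous continuous_const)
      (hcl hA hAne hz)
  have hfB' : ∀ z ∈ B, c ≤ f z := fun z hz =>
    closure_minimal (fun w hw => (hfB w hw).le) (isClosed_le continuous_const f.continuous)
      (hcl hB hBne hz)
  have hfa : f a = c := le_antisymm (hfA' a (hSA haS).1) (hfB' a (hTB haT).1)
  have hfb : f b = c := le_antisymm (hfA' b (hSA hbS).1) (hfB' b (hTB hbT).1)
  have hVA' : Disjoint V A := (hVA.closure_right hV).mono_right (hcl hA hAne)
  have hVB' : Disjoint V B := (hVB.closure_right hV).mono_right (hcl hB hBne)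
  obtain ⟨u, hu⟩ := hAne
  obtain ⟨v, hv⟩ := hBne
  have hfu := hfA u hu
  have hfv := hfB v hv
  have huC : u ∈ interior C := interior_mono hAC hu
  have hvC : v ∈ interior C := interior_mono hBC hv
  by_cases hm : midpoint ℝ a b ∈ interior C
  · obtain ⟨p, hpV, hfp⟩ : ∃ p ∈ V, f p ≠ c := by
      by_contra! h
      have hf0 : f ≠ 0 := by
        rintro rfl
        simp only [_root_.zero_apply] at hfu hfv
        linarith
      have hop := f.isOpenMap_of_ne_zero hf0 V hV
      have himg : f '' V = {c} := by
        obtain ⟨w, hw⟩ := hVne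
        exact eq_singleton_iff_unique_mem.2
          ⟨⟨w, hw, h w hw⟩, by rintro _ ⟨z, hz, rfl⟩; exact h z hz⟩
      exact not_isOpen_singleton c (himg ▸ hop)
    have hpC : p ∈ interior C := interior_maximal hVC hV hpV
    rcases hfp.lt_or_gt with hlt | hgt
    · exact hVA'.notMem_of_mem_left hpV <|
        mem_of_isPreconnected_of_lt hC hA hS (fun z hz => (hSA hz).1) (fun z hz => (hSA hz).2)
          haS hbS hm f hfA' hfa hfb hpC hlt
    · exact hVB'.notMem_of_mem_left hpV <|
        mem_of_isPreconnected_of_lt hC hB hT (fun z hz => (hTB hz).1) (fun z hz => (hTB hz).2)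
          haT hbT hm (-f) (c := -c) (fun z hz => neg_le_neg (hfB' z hz)) (by simp [hfa])
          (by simp [hfb]) hpC (neg_lt_neg hgt)
  · obtain ⟨g, hg⟩ := geometric_hahn_banach_open_point hC.interior isOpen_interior hm
    have hgC : ∀ z ∈ C, g z ≤ g (midpoint ℝ a b) := fun z hz =>
      closure_minimal (fun w hw => (hg w hw).le) (isClosed_le g.continuous continuous_const)
        (hcl hC ⟨u, huC⟩ hz)
    have hga := hgC a (hAC (hSA haS).1)
    have hgb := hgC b (hAC (hSA hbS).1)
    have hgu := hg u huC
    have hgv := hg v hvC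
    have hgm : g (midpoint ℝ a b) = (g a + g b) / 2 := by
      rw [midpoint_eq_smul_add, map_smul, map_add, invOf_eq_inv, smul_eq_mul]; ring
    rw [hgm] at hga hgb hgu hgv
    have key := Complex.dual_mul_comm_of_apply_eq_zero f g (d := b - a)
      (sub_ne_zero.2 (Ne.symm hne)) (by rw [map_sub, hfa, hfb, sub_self])
      (by rw [map_sub]; linarith) (u - a) (v - a)
    simp only [map_sub, hfa] at key
    have h1 : 0 < (f u - c) * (g v - g a) := mul_pos_of_neg_of_neg (by linarith) (by linarith)
    have h2 : (f v - c) * (g u - g a) < 0 := mul_neg_of_pos_of_neg (by linarith) (by linarith)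
    linarith

/-- A compact set covered by images of itself under contractions that preserve `O` lies in the
closure of `O`. -/
lemma IsCompact.subset_closure_of_contracting {X ι : Type*} [PseudoMetricSpace X] {K O : Set X}
    (hK : IsCompact K) (hO : O.Nonempty) (φ : ι → X → X) (q : ι → ℝ) (hq0 : ∀ i, 0 ≤ q i)
    (hq1 : ∀ i, q i < 1) (hφ : ∀ i x y, dist (φ i x) (φ i y) ≤ q i * dist x y)
    (hKφ : K ⊆ ⋃ i, φ i '' K) (hOφ : ∀ i, MapsTo (φ i) O O) : K ⊆ closure O := by
  intro x hx
  obtain ⟨y, hyK, hy⟩ := hK.exists_isMaxOn ⟨x, hx⟩ (Metric.continuous_infDist_pt O).continuousOn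
  obtain ⟨i, z, hzK, rfl⟩ := mem_iUnion.1 (hKφ hyK)
  have h1 : Metric.infDist (φ i z) O ≤ q i * Metric.infDist z O := by
    rcases (hq0 i).eq_or_lt with h | h
    · obtain ⟨o, ho⟩ := hO
      rw [← h, zero_mul]
      calc Metric.infDist (φ i z) O ≤ dist (φ i z) (φ i o) :=
            Metric.infDist_le_dist_of_mem (hOφ i ho)
        _ ≤ 0 := by simpa [← h] using hφ i z o
    · rw [← div_le_iff₀' h]
      refine (Metric.le_infDist hO).2 fun o ho => ?_
      rw [div_le_iff₀' h]
      exact (Metric.infDist_le_dist_of_mem (hOφ i ho)).trans (hφ i z o)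
  have h2 : Metric.infDist z O ≤ Metric.infDist (φ i z) O := hy hzK
  have h3 : Metric.infDist x O ≤ Metric.infDist (φ i z) O := hy hx
  have h4 : 0 ≤ Metric.infDist z O := Metric.infDist_nonneg
  rw [Metric.mem_closure_iff_infDist_zero hO]
  have h5 := hq1 i
  have h6 : 0 ≤ Metric.infDist x O := Metric.infDist_nonneg
  have h7 : Metric.infDist z O = 0 := by nlinarith
  rw [h7, mul_zero] at h1
  linarith

/-- Proposition 4, part 2: if `n > 2` and the system satisfies the open convex set condition,
then for `i ≠ j` the intersection of a connected component of `Qᵢ = φᵢ(K̃) ∩ frontier K̃`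
with a connected component of `Qⱼ` is empty or a single point. -/
theorem components_intersection_subsingleton
    (n : ℕ) (hn : 2 < n)
    (qs αs : Fin n → ℝ) (zs : Fin n → ℂ)
    (hqs : ∀ i, 0 < qs i ∧ qs i < 1)
    (φ : Fin n → ℂ → ℂ)
    (hφ : ∀ i z, φ i z = (qs i : ℂ) * Complex.exp (Complex.I * (αs i : ℂ)) * (z - zs i) + zs i)
    (K : Set ℂ) (hKne : K.Nonempty) (hKc : IsCompact K)
    (hKinv : K = ⋃ i, φ i '' K)
    (hOCSC : ∃ O : Set ℂ, O.Nonempty ∧ IsOpen O ∧ Convex ℝ O ∧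
      (⋃ i, φ i '' O) ⊆ O ∧ ∀ i j, i ≠ j → φ i '' O ∩ φ j '' O = ∅)
    (hint : (interior (convexHull ℝ K)).Nonempty)
    (Q : Fin n → Set ℂ)
    (hQ : ∀ i, Q i = φ i '' (convexHull ℝ K) ∩ frontier (convexHull ℝ K))
    (i j : Fin n) (hij : i ≠ j)
    (x y : ℂ) (hx : x ∈ Q i) (hy : y ∈ Q j) :
    (connectedComponentIn (Q i) x ∩ connectedComponentIn (Q j) y).Subsingleton := by
  obtain ⟨O, hOne, hOo, hOc, hOsub, hOdis⟩ := hOCSC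
  set r : Fin n → ℂ := fun i => (qs i : ℂ) * Complex.exp (Complex.I * (αs i : ℂ)) with hr
  have hr0 : ∀ i, r i ≠ 0 := fun i =>
    mul_ne_zero (Complex.ofReal_ne_zero.2 (hqs i).1.ne') (Complex.exp_ne_zero _)
  have hrn : ∀ i, ‖r i‖ = qs i := fun i => by
    rw [hr, norm_mul, mul_comm Complex.I, Complex.norm_exp_ofReal_mul_I, mul_one,
      Complex.norm_real, Real.norm_of_nonneg (hqs i).1.le]
  have hhomeo : ∀ i, ∃ e : ℂ ≃ₜ ℂ, ⇑e = φ i := fun i =>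
    ⟨((Homeomorph.subRight (zs i)).trans (Homeomorph.mulLeft₀ (r i) (hr0 i))).trans
      (Homeomorph.addRight (zs i)), by ext z; simp [hφ, hr]⟩
  have haff : ∀ i, ∃ e : ℂ →ᵃ[ℝ] ℂ, ⇑e = φ i := fun i =>
    ⟨(LinearMap.mulLeft ℝ (r i)).toAffineMap + AffineMap.const ℝ ℂ (zs i - r i * zs i), by
      ext z; simp [hφ, hr]; ring⟩
  set C := convexHull ℝ K
  have hC : Convex ℝ C := convex_convexHull ℝ K
  have hφC : ∀ i, φ i '' C ⊆ C := by
    intro i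
    obtain ⟨e, he⟩ := haff i
    rw [← he, AffineMap.image_convexHull, he]
    refine convexHull_mono ?_
    conv_rhs => rw [hKinv]
    exact subset_iUnion (fun i => φ i '' K) i
  have hφconv : ∀ i, Convex ℝ (φ i '' C) := by
    intro i
    obtain ⟨e, he⟩ := haff i
    exact he ▸ hC.affine_image e
  have hφint : ∀ i, interior (φ i '' C) = φ i '' interior C := by
    intro i
    obtain ⟨e, he⟩ := hhomeo i
    rw [← he, e.image_interior]
  have hKO : K ⊆ closure O :=
    hKc.subset_closure_of_contracting hOne φ qs (fun i => (hqs i).1.le) (fun i => (hqs i).2)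
      (fun i x y => by
        rw [hφ, hφ, dist_add_right, dist_eq_norm, ← mul_sub, norm_mul, hrn i, dist_eq_norm,
          sub_sub_sub_cancel_right])
      hKinv.subset (fun i z hz => hOsub (mem_iUnion.2 ⟨i, mem_image_of_mem _ hz⟩))
  have hCO : interior C ⊆ O := by
    rw [← hOo.interior_eq, ← hOc.interior_closure_eq_interior_of_nonempty_interior
      (hOo.interior_eq.symm ▸ hOne)]
    exact interior_mono (convexHull_min hKO hOc.closure)
  have hdis : ∀ i j, i ≠ j → Disjoint (interior (φ i '' C)) (interior (φ j '' C)) := by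
    intro i j hij
    rw [hφint, hφint]
    exact (disjoint_iff_inter_eq_empty.2 (hOdis i j hij)).mono (image_mono hCO) (image_mono hCO)
  have hne : ∀ i, (interior (φ i '' C)).Nonempty := fun i => hφint i ▸ hint.image _
  obtain ⟨k, hki, hkj⟩ : ∃ k, k ≠ i ∧ k ≠ j :=
    ENat.exists_ne_ne_of_three_le (by simpa using Nat.succ_le_of_lt hn) i j
  exact subsingleton_inter_of_disjoint_interior hC (hφconv i) (hφconv j) (hφC i) (hφC j) (hne i)
    (hne j) (hdis i j hij) isOpen_interior (hne k) (interior_subset.trans (hφC k)) (hdis k i hki)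
    (hdis k j hkj) isPreconnected_connectedComponentIn
    (hQ i ▸ connectedComponentIn_subset (Q i) x) isPreconnected_connectedComponentIn
    (hQ j ▸ connectedComponentIn_subset (Q j) y)
end

section
/- Suppose the system (φ₁,…,φₙ) satisfies the open convex set condition and the interior of K̃ = convexHull ℝ K is nonempty. Then the set frontier K̃ \ ⋃ᵢ (φᵢ(K̃) ∩ frontier K̃) has at most 2n − 2 connected components (these are the sides of order 1 of K̃, with their endpoints removed). -/
open Set

/-- A closed curve meeting sets `L i` in a noncrossing pattern, such that no gap
between them has both ends in the same `L i`, has at most `2 * n - 2` gaps. -/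
theorem card_components_le_of_noncrossing {n : ℕ} (γ : ℝ → ℂ) (hγ : Continuous γ)
    (hper : Function.Periodic γ (2 * Real.pi)) (L : Fin n → Set ℂ)
    (gap : ∀ t, (∀ i, γ t ∉ L i) → ∃ a b, a < t ∧ t < b ∧ (∃ i, γ a ∈ L i) ∧ (∃ j, γ b ∈ L j) ∧
      (∀ s ∈ Ioo a b, ∀ i, γ s ∉ L i) ∧ ∀ i, γ a ∈ L i → γ b ∉ L i)
    (cross : ∀ i j, i ≠ j → ∀ h a b l, h < a → a < b → b < l → l < h + 2 * Real.pi →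
      γ h ∈ L i → γ a ∈ L j → γ b ∈ L i → γ l ∈ L j → False)
    (S : Set ℂ) (hS : S = range γ \ ⋃ i, L i) :
    Finite (ConnectedComponents S) ∧ Nat.card (ConnectedComponents S) ≤ 2 * n - 2 := by
  classical
  rcases S.eq_empty_or_nonempty with hemp | ⟨p, hp⟩
  · have : IsEmpty (ConnectedComponents S) := by
      refine ⟨fun κ => ?_⟩
      obtain ⟨⟨x, hx⟩, -⟩ := ConnectedComponents.surjective_coe κ
      simp [hemp] at hx
    exact ⟨inferInstance, by simp⟩
  have hSmem : ∀ t, γ t ∈ S ↔ ∀ i, γ t ∉ L i := by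
    intro t; simp [hS]
  obtain ⟨s₀, c₀, hc₀⟩ : ∃ s₀ c₀, γ s₀ ∈ L c₀ := by
    have hp' := hp
    rw [hS] at hp'
    obtain ⟨t, rfl⟩ := hp'.1
    obtain ⟨a, b, -, -, ⟨i, hi⟩, -⟩ := gap t ((hSmem t).1 hp)
    exact ⟨a, i, hi⟩
  have hc₁ : γ (s₀ + 2 * Real.pi) ∈ L c₀ := by rwa [hper]
  have hrep : ∀ κ : ConnectedComponents S, ∃ t, s₀ < t ∧ t < s₀ + 2 * Real.pi ∧
      ∃ h : γ t ∈ S, ((⟨γ t, h⟩ : S) : ConnectedComponents S) = κ := by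
    intro κ
    obtain ⟨⟨x, hx⟩, rfl⟩ := ConnectedComponents.surjective_coe κ
    have hx' := hx
    rw [hS] at hx'
    obtain ⟨t, rfl⟩ := hx'.1
    obtain ⟨u, hu, hut⟩ := hper.exists_mem_Ico (by positivity) t s₀
    have huS : γ u ∈ S := hut ▸ hx
    refine ⟨u, lt_of_le_of_ne hu.1 ?_, hu.2, huS, ?_⟩
    · rintro rfl
      exact (hSmem _).1 huS _ hc₀
    · congr 2
      exact hut.symm
  choose t ht0 ht1 htS htκ using hrep
  have hgap := fun κ => gap (t κ) ((hSmem _).1 (htS κ))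
  choose a b hat htb hx hy hab hdisj using hgap
  choose x hx using hx
  choose y hy using hy
  have hsa : ∀ κ, s₀ ≤ a κ := fun κ => by
    by_contra! h
    exact hab κ s₀ ⟨h, (ht0 κ).trans (htb κ)⟩ _ hc₀
  have hbs : ∀ κ, b κ ≤ s₀ + 2 * Real.pi := fun κ => by
    by_contra! h
    exact hab κ _ ⟨(hat κ).trans (ht1 κ), h⟩ _ hc₁
  have hxy : ∀ κ, x κ ≠ y κ := fun κ h => hdisj κ _ (hx κ) (h ▸ hy κ)
  have hjoin : ∀ κ κ', t κ < t κ' → (∀ s ∈ Icc (t κ) (t κ'), ∀ i, γ s ∉ L i) → κ = κ' := by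
    intro κ κ' hlt hs
    rw [← htκ κ, ← htκ κ', ConnectedComponents.coe_eq_coe']
    have hpre : IsPreconnected ((↑) ⁻¹' (γ '' Icc (t κ) (t κ')) : Set S) := by
      rw [← Topology.IsInducing.subtypeVal.isPreconnected_image, Subtype.image_preimage_coe,
        inter_eq_right.2]
      · exact isPreconnected_Icc.image _ hγ.continuousOn
      · rintro _ ⟨s, h, rfl⟩
        exact (hSmem s).2 (hs s h)
    exact hpre.subset_connectedComponent (mem_image_of_mem _ (right_mem_Icc.2 hlt.le))
      (mem_image_of_mem _ (left_mem_Icc.2 hlt.le))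
  have hbt : ∀ κ κ', t κ < t κ' → b κ < t κ' := by
    intro κ κ' hlt
    by_contra! h
    refine hlt.ne (congrArg t (hjoin κ κ' hlt fun s hs => ?_))
    rcases hs.2.eq_or_lt with rfl | h'
    · exact (hSmem _).1 (htS κ')
    · exact hab κ s ⟨(hat κ).trans_le hs.1, h'.trans_le h⟩
  have hta : ∀ κ κ', t κ < t κ' → t κ < a κ' := by
    intro κ κ' hlt
    by_contra! h
    refine hlt.ne (congrArg t (hjoin κ κ' hlt fun s hs => ?_))
    rcases hs.1.eq_or_lt with rfl | h'
    · exact (hSmem _).1 (htS κ)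
    · exact hab κ' s ⟨h.trans_lt h', hs.2.trans_lt (htb κ')⟩
  have hinj : ∀ κ κ', t κ = t κ' → κ = κ' := by
    intro κ κ' h
    rw [← htκ κ, ← htκ κ']
    congr 2
    exact congrArg γ h
  let E : ConnectedComponents S → Prop := fun κ => y κ ≠ c₀ ∧ ∀ s ∈ Ioo s₀ (t κ), γ s ∉ L (y κ)
  let F : ConnectedComponents S → Prop := fun κ =>
    x κ ≠ c₀ ∧ ∀ s ∈ Ioo (t κ) (s₀ + 2 * Real.pi), γ s ∉ L (x κ)
  have hEF : ∀ κ, ¬ E κ → F κ := by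
    intro κ hE
    by_contra hF
    obtain ⟨h, hh0, hha, hhy, hh⟩ : ∃ h, s₀ ≤ h ∧ h ≤ a κ ∧ γ h ∈ L (y κ) ∧
        (h = s₀ → y κ = c₀) := by
      by_cases hyc : y κ = c₀
      · exact ⟨s₀, le_rfl, hsa κ, hyc ▸ hc₀, fun _ => hyc⟩
      · simp only [E, not_and, not_forall, not_not] at hE
        obtain ⟨s, hs, hsL⟩ := hE hyc
        refine ⟨s, hs.1.le, ?_, hsL, fun h => absurd h hs.1.ne'⟩
        by_contra! h
        exact hab κ s ⟨h, hs.2.trans (htb κ)⟩ _ hsL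
    obtain ⟨l, hl0, hlb, hlx, hl⟩ : ∃ l, l ≤ s₀ + 2 * Real.pi ∧ b κ ≤ l ∧ γ l ∈ L (x κ) ∧
        (l = s₀ + 2 * Real.pi → x κ = c₀) := by
      by_cases hxc : x κ = c₀
      · exact ⟨_, le_rfl, hbs κ, hxc ▸ hc₁, fun _ => hxc⟩
      · simp only [F, not_and, not_forall, not_not] at hF
        obtain ⟨s, hs, hsL⟩ := hF hxc
        refine ⟨s, hs.2.le, ?_, hsL, fun h => absurd h hs.2.ne⟩
        by_contra! h
        exact hab κ s ⟨(hat κ).trans hs.1, h⟩ _ hsL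
    have h1 : h ≠ a κ := by
      rintro rfl
      exact hdisj κ _ hhy (hy κ)
    have h2 : b κ ≠ l := by
      rintro rfl
      exact hdisj κ _ (hx κ) hlx
    refine cross (y κ) (x κ) (hxy κ).symm h (a κ) (b κ) l (lt_of_le_of_ne hha h1)
      ((hat κ).trans (htb κ)) (lt_of_le_of_ne hlb h2) ?_ hhy (hx κ) (hy κ) hlx
    rcases hh0.eq_or_lt with h3 | h3
    · rcases hl0.eq_or_lt with h4 | h4
      · exact absurd ((hl h4).trans (hh h3.symm).symm) (hxy κ)
      · linarith
    · linarith
  let G : ConnectedComponents S → {i : Fin n // i ≠ c₀} ⊕ {i : Fin n // i ≠ c₀} := fun κ =>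
    if h : E κ then Sum.inl ⟨y κ, h.1⟩ else Sum.inr ⟨x κ, (hEF κ h).1⟩
  have hG : Function.Injective G := by
    have key : ∀ κ κ', t κ < t κ' → G κ ≠ G κ' := by
      intro κ κ' hlt hGG
      by_cases h : E κ <;> by_cases h' : E κ' <;> simp only [G, h, h', dif_pos, dif_neg,
        not_false_eq_true, Sum.inl.injEq, Sum.inr.injEq, Subtype.mk.injEq, reduceCtorEq] at hGG
      · exact h'.2 (b κ) ⟨(ht0 κ).trans (htb κ), hbt κ κ' hlt⟩ (hGG ▸ hy κ)
      · exact (hEF κ h).2 (a κ') ⟨hta κ κ' hlt, (hat κ').trans (ht1 κ')⟩ (hGG ▸ hx κ')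
    intro κ κ' h
    rcases lt_trichotomy (t κ) (t κ') with h1 | h1 | h1
    · exact absurd h (key _ _ h1)
    · exact hinj _ _ h1
    · exact absurd h.symm (key _ _ h1)
  refine ⟨Finite.of_injective G hG, (Nat.card_le_card_of_injective G hG).trans ?_⟩
  simp only [Nat.card_eq_fintype_card, Fintype.card_sum, Fintype.card_subtype_compl,
    Fintype.card_fin, Fintype.card_subtype_eq]
  omega

/-- The unit vector of argument `t`. -/
noncomputable def circleDir (t : ℝ) : ℂ := Real.cos t + Real.sin t * Complex.I

theorem continuous_circleDir : Continuous circleDir := by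
  unfold circleDir
  fun_prop

theorem circleDir_periodic : Function.Periodic circleDir (2 * Real.pi) := by
  intro t
  simp [circleDir]

theorem circleDir_ne_zero (t : ℝ) : circleDir t ≠ 0 := by
  intro h
  have h1 := congrArg Complex.re h
  have h2 := congrArg Complex.im h
  have h3 := Real.sin_sq_add_cos_sq t
  simp [circleDir, -Complex.ofReal_cos, -Complex.ofReal_sin] at h1 h2
  simp [h1, h2] at h3

theorem norm_smul_circleDir_arg (z : ℂ) : ‖z‖ • circleDir (Complex.arg z) = z := by
  apply Complex.ext <;>
  simp [circleDir, -Complex.ofReal_cos, -Complex.ofReal_sin, Complex.norm_mul_cos_arg,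
    Complex.norm_mul_sin_arg]

theorem sin_smul_circleDir (s u v : ℝ) :
    Real.sin (v - s) • circleDir u =
      Real.sin (v - u) • circleDir s + Real.sin (u - s) • circleDir v := by
  have h := Real.sin_sq_add_cos_sq u
  apply Complex.ext <;>
  simp only [circleDir, Real.sin_sub, Complex.real_smul, Complex.add_re, Complex.add_im,
    Complex.re_ofReal_mul, Complex.im_ofReal_mul, Complex.ofReal_re, Complex.ofReal_im,
    Complex.I_re, Complex.I_im] <;> ring

/-- A function on the circle that lies above its sinusoidal interpolants on arcs of length at
most `π`. -/
def SineConcave (H : ℝ → ℝ) : Prop :=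
  ∀ s u v, s ≤ u → u ≤ v → v ≤ s + Real.pi →
    Real.sin (v - u) * H s + Real.sin (u - s) * H v ≤ Real.sin (v - s) * H u

theorem SineConcave.pos_of_lt {H : ℝ → ℝ} (hH : SineConcave H) {s u v : ℝ} (hsu : s < u)
    (huv : u < v) (hvs : v ≤ s + Real.pi) (hs : 0 ≤ H s) (hv : 0 ≤ H v) (hsv : 0 < H s + H v) :
    0 < H u := by
  have h1 : 0 < Real.sin (v - u) := Real.sin_pos_of_pos_of_lt_pi (by linarith) (by linarith)
  have h2 : 0 < Real.sin (u - s) := Real.sin_pos_of_pos_of_lt_pi (by linarith) (by linarith)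
  have h3 : 0 ≤ Real.sin (v - s) := Real.sin_nonneg_of_nonneg_of_le_pi (by linarith) (by linarith)
  have h4 := hH s u v hsu.le huv.le hvs
  by_contra! h
  have h5 : Real.sin (v - s) * H u ≤ 0 := mul_nonpos_of_nonneg_of_nonpos h3 h
  rcases hs.eq_or_lt with h6 | h6
  · have : 0 < H v := by linarith
    nlinarith [mul_pos h2 this, mul_nonneg h1.le hs]
  · nlinarith [mul_pos h1 h6, mul_nonneg h2.le hv]

theorem SineConcave.not_alternating {H : ℝ → ℝ} (hH : SineConcave H)
    (hper : Function.Periodic H (2 * Real.pi)) {s u v w : ℝ} (hsu : s < u) (huv : u < v)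
    (hvw : v < w) (hws : w < s + 2 * Real.pi) (hs : 0 ≤ H s) (hv : 0 ≤ H v)
    (hsv : 0 < H s + H v) (hu : H u ≤ 0) (hw : H w ≤ 0) : False := by
  by_cases h : v ≤ s + Real.pi
  · exact (hH.pos_of_lt hsu huv h hs hv hsv).not_ge hu
  · refine (hH.pos_of_lt hvw hws (by linarith) hv ?_ ?_).not_ge hw <;> rw [hper] <;> linarith

theorem sineConcave_sub_gauge {C : Set ℂ} (hC : Convex ℝ C) (h0 : C ∈ nhds 0) (f : ℂ →L[ℝ] ℝ)
    {c : ℝ} (hc : 0 ≤ c) :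
    SineConcave fun t => f (circleDir t) - c * gauge C (circleDir t) := by
  intro s u v hsu huv hvs
  have h1 : 0 ≤ Real.sin (v - u) := Real.sin_nonneg_of_nonneg_of_le_pi (by linarith) (by linarith)
  have h2 : 0 ≤ Real.sin (u - s) := Real.sin_nonneg_of_nonneg_of_le_pi (by linarith) (by linarith)
  have h3 : 0 ≤ Real.sin (v - s) := Real.sin_nonneg_of_nonneg_of_le_pi (by linarith) (by linarith)
  have hid := sin_smul_circleDir s u v
  have hf := congrArg f hid
  have hg := gauge_add_le hC (absorbent_nhds_zero h0) (Real.sin (v - u) • circleDir s)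
    (Real.sin (u - s) • circleDir v)
  rw [← hid, gauge_smul_of_nonneg h1, gauge_smul_of_nonneg h2, gauge_smul_of_nonneg h3] at hg
  simp only [map_add, map_smul, smul_eq_mul] at hf hg
  nlinarith [mul_le_mul_of_nonneg_left hg hc]

/-- The point at which the ray of argument `t` from the origin leaves `C`. -/
noncomputable def radialPoint (C : Set ℂ) (t : ℝ) : ℂ :=
  (gauge C (circleDir t))⁻¹ • circleDir t

theorem radialPoint_periodic (C : Set ℂ) : Function.Periodic (radialPoint C) (2 * Real.pi) := by
  intro t
  simp only [radialPoint, circleDir_periodic t]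

theorem gauge_circleDir_pos {C : Set ℂ} (h0 : C ∈ nhds 0) (hb : Bornology.IsBounded C) (t : ℝ) :
    0 < gauge C (circleDir t) :=
  (gauge_pos (absorbent_nhds_zero h0) ((NormedSpace.isVonNBounded_iff ℝ).2 hb)).2
    (circleDir_ne_zero t)

theorem continuous_radialPoint {C : Set ℂ} (hC : Convex ℝ C) (h0 : C ∈ nhds 0)
    (hb : Bornology.IsBounded C) : Continuous (radialPoint C) :=
  (((continuous_gauge hC h0).comp continuous_circleDir).inv₀
    fun t => (gauge_circleDir_pos h0 hb t).ne').smul continuous_circleDir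

theorem gauge_radialPoint {C : Set ℂ} (h0 : C ∈ nhds 0) (hb : Bornology.IsBounded C) (t : ℝ) :
    gauge C (radialPoint C t) = 1 := by
  have h := gauge_circleDir_pos h0 hb t
  rw [radialPoint, gauge_smul_of_nonneg (by positivity), smul_eq_mul, inv_mul_cancel₀ h.ne']

theorem radialPoint_arg {C : Set ℂ} {z : ℂ} (hz : gauge C z = 1) :
    radialPoint C (Complex.arg z) = z := by
  have h := norm_smul_circleDir_arg z
  have h1 : ‖z‖ * gauge C (circleDir (Complex.arg z)) = 1 := by
    rw [← smul_eq_mul, ← gauge_smul_of_nonneg (norm_nonneg z), h, hz]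
  rw [radialPoint, ← eq_inv_of_mul_eq_one_left h1, h]

theorem range_radialPoint {C : Set ℂ} (hC : Convex ℝ C) (h0 : C ∈ nhds 0)
    (hb : Bornology.IsBounded C) : range (radialPoint C) = frontier C := by
  ext z
  rw [← gauge_eq_one_iff_mem_frontier hC h0]
  exact ⟨by rintro ⟨t, rfl⟩; exact gauge_radialPoint h0 hb t, fun h => ⟨_, radialPoint_arg h⟩⟩

theorem apply_radialPoint_eq {C : Set ℂ} (h0 : C ∈ nhds 0) (hb : Bornology.IsBounded C)
    (f : ℂ →L[ℝ] ℝ) (c t : ℝ) :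
    f (circleDir t) - c * gauge C (circleDir t) =
      gauge C (circleDir t) * (f (radialPoint C t) - c) := by
  have h := gauge_circleDir_pos h0 hb t
  simp only [radialPoint, map_smul, smul_eq_mul]
  field_simp

/-- If the level `c ≥ 0` of `f` is exceeded in the interior of `C`, then `f - c` cannot
alternate in sign four times along the boundary of `C`. -/
theorem not_alternating_radialPoint {C : Set ℂ} (hC : Convex ℝ C) (h0 : C ∈ nhds 0)
    (hb : Bornology.IsBounded C) (f : ℂ →L[ℝ] ℝ) {c : ℝ} (hc : 0 ≤ c) {z : ℂ} (hz : z ∈ C)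
    (hfz : c < f z) {t₁ t₂ t₃ t₄ : ℝ} (h12 : t₁ < t₂) (h23 : t₂ < t₃) (h34 : t₃ < t₄)
    (h41 : t₄ < t₁ + 2 * Real.pi) (h1 : f (radialPoint C t₁) ≤ c) (h2 : c ≤ f (radialPoint C t₂))
    (h3 : f (radialPoint C t₃) ≤ c) (h4 : c ≤ f (radialPoint C t₄)) : False := by
  set H : ℝ → ℝ := fun t => f (circleDir t) - c * gauge C (circleDir t) with hHdef
  have hH : SineConcave H := sineConcave_sub_gauge hC h0 f hc
  have hper : Function.Periodic H (2 * Real.pi) := fun t => by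
    simp only [hHdef, circleDir_periodic t]
  have hHt : ∀ t, H t = gauge C (circleDir t) * (f (radialPoint C t) - c) :=
    apply_radialPoint_eq h0 hb f c
  have hg := fun t => (gauge_circleDir_pos h0 hb t).le
  have H1 : H t₁ ≤ 0 := by rw [hHt]; exact mul_nonpos_of_nonneg_of_nonpos (hg _) (by linarith)
  have H3 : H t₃ ≤ 0 := by rw [hHt]; exact mul_nonpos_of_nonneg_of_nonpos (hg _) (by linarith)
  have H2 : 0 ≤ H t₂ := by rw [hHt]; exact mul_nonneg (hg _) (by linarith)
  have H4 : 0 ≤ H t₄ := by rw [hHt]; exact mul_nonneg (hg _) (by linarith)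
  have H1' : H (t₁ + 2 * Real.pi) ≤ 0 := by rwa [hper]
  obtain ⟨τ, hτ, hτH⟩ : ∃ τ ∈ Ico t₁ (t₁ + 2 * Real.pi), 0 < H τ := by
    obtain ⟨τ, hτ, hτH⟩ := hper.exists_mem_Ico (by positivity) (Complex.arg z) t₁
    refine ⟨τ, hτ, hτH ▸ ?_⟩
    have hn := norm_smul_circleDir_arg z
    have h5 : ‖z‖ * gauge C (circleDir (Complex.arg z)) ≤ 1 := by
      rw [← smul_eq_mul, ← gauge_smul_of_nonneg (norm_nonneg z), hn]
      exact gauge_le_one_of_mem hz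
    have h6 : ‖z‖ * f (circleDir (Complex.arg z)) = f z := by
      rw [← smul_eq_mul, ← map_smul, hn]
    by_contra! h7
    simp only [hHdef] at h7
    nlinarith [norm_nonneg z, mul_le_mul_of_nonneg_left h5 hc,
      mul_le_mul_of_nonneg_left h7 (norm_nonneg z)]
  have n1 : t₁ ≠ τ := by rintro rfl; linarith
  have n3 : t₃ ≠ τ := by rintro rfl; linarith
  have hτ1 := lt_of_le_of_ne hτ.1 n1
  rcases n3.lt_or_gt with h | h
  · exact hH.not_alternating hper h23 h hτ.2 (by linarith) H2 hτH.le (by linarith) H3 H1'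
  · exact hH.not_alternating hper h h34 h41 (by linarith) hτH.le H4 (by linarith) H3 H1'

theorem radialPoint_noncrossing {C : Set ℂ} (hC : Convex ℝ C) (h0 : C ∈ nhds 0)
    (hb : Bornology.IsBounded C) {A B : Set ℂ} (hA : Convex ℝ A) (hB : Convex ℝ B)
    (hAC : A ⊆ C) (hBC : B ⊆ C) (hAi : (interior A).Nonempty) (hBi : (interior B).Nonempty)
    (hAB : Disjoint (interior A) (interior B)) {t₁ t₂ t₃ t₄ : ℝ} (h12 : t₁ < t₂) (h23 : t₂ < t₃)
    (h34 : t₃ < t₄) (h41 : t₄ < t₁ + 2 * Real.pi) (h1 : radialPoint C t₁ ∈ A)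
    (h2 : radialPoint C t₂ ∈ B) (h3 : radialPoint C t₃ ∈ A) (h4 : radialPoint C t₄ ∈ B) :
    False := by
  obtain ⟨f, c, hfA, hfB⟩ := geometric_hahn_banach_open_open hA.interior isOpen_interior
    hB.interior isOpen_interior hAB
  have hfA' : ∀ z ∈ A, f z ≤ c := by
    have : closure (interior A) ⊆ f ⁻¹' Iic c :=
      closure_minimal (fun z hz => (hfA z hz).le) (isClosed_Iic.preimage f.continuous)
    rw [hA.closure_interior_eq_closure_of_nonempty_interior hAi] at this
    exact fun z hz => this (subset_closure hz)
  have hfB' : ∀ z ∈ B, c ≤ f z := by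
    have : closure (interior B) ⊆ f ⁻¹' Ici c :=
      closure_minimal (fun z hz => (hfB z hz).le) (isClosed_Ici.preimage f.continuous)
    rw [hB.closure_interior_eq_closure_of_nonempty_interior hBi] at this
    exact fun z hz => this (subset_closure hz)
  rcases le_total 0 c with hc | hc
  · obtain ⟨z, hz⟩ := hBi
    exact not_alternating_radialPoint hC h0 hb f hc (hBC (interior_subset hz)) (hfB z hz)
      h12 h23 h34 h41 (hfA' _ h1) (hfB' _ h2) (hfA' _ h3) (hfB' _ h4)
  · obtain ⟨z, hz⟩ := hAi
    refine not_alternating_radialPoint hC h0 hb (-f) (neg_nonneg.2 hc)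
      (hAC (interior_subset hz)) (neg_lt_neg (hfA z hz))
      h23 h34 h41 (by linarith : t₁ + 2 * Real.pi < t₂ + 2 * Real.pi)
      (neg_le_neg (hfB' _ h2)) (neg_le_neg (hfA' _ h3)) (neg_le_neg (hfB' _ h4)) ?_
    rw [radialPoint_periodic]
    exact neg_le_neg (hfA' _ h1)

/-- A point of `convexHull ℝ A \ A` on a supporting line has points of `A` on that line on
either side. -/
theorem exists_mem_of_mem_convexHull_of_forall_le {A : Set ℂ} {p : ℂ} (hp : p ∈ convexHull ℝ A)
    (hpA : p ∉ A) (f g : ℂ →L[ℝ] ℝ) (hf : ∀ z ∈ A, f z ≤ f p) (hgp : g p = 0)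
    (hinj : ∀ z, f z = f p → g z = 0 → z = p) : ∃ q ∈ A, f q = f p ∧ 0 < g q := by
  by_contra! h
  have hsub : A ⊆ {z | f z < f p ∨ (f z ≤ f p ∧ g z < 0)} := by
    intro z hz
    rcases (hf z hz).lt_or_eq with h1 | h1
    · exact Or.inl h1
    · refine Or.inr ⟨h1.le, lt_of_le_of_ne (h z hz h1) fun h2 => hpA ?_⟩
      rwa [← hinj z h1 h2]
  have hconv : Convex ℝ {z | f z < f p ∨ (f z ≤ f p ∧ g z < 0)} := by
    rw [convex_iff_forall_pos]
    intro x hx y hy a b ha hb hab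
    simp only [mem_ofPred_eq, map_add, map_smul, smul_eq_mul] at hx hy ⊢
    have hb' : b = 1 - a := by linarith
    have h3 : a * f p + b * f p = f p := by rw [hb']; ring
    rcases hx with hx | ⟨hx, hx'⟩ <;> rcases hy with hy | ⟨hy, hy'⟩
    · left; nlinarith
    · left; nlinarith
    · left; nlinarith
    · right; constructor <;> nlinarith
  have := convexHull_min hsub hconv hp
  simp [hgp] at this

theorem IsCompact.convexHull_complex {A : Set ℂ} (hA : IsCompact A) :
    IsCompact (convexHull ℝ A) := by
  have himg : convexHull ℝ A = (fun p : ℂ × ℂ × ℂ × ℝ × ℝ =>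
      p.1 + p.2.2.2.2 • ((p.2.1 + p.2.2.2.1 • (p.2.2.1 - p.2.1)) - p.1)) ''
        (A ×ˢ A ×ˢ A ×ˢ Icc (0 : ℝ) 1 ×ˢ Icc (0 : ℝ) 1) := by
    apply Subset.antisymm
    · intro x hx
      rw [convexHull_eq_union] at hx
      simp only [mem_iUnion] at hx
      obtain ⟨t, htA, hai, hxt⟩ := hx
      have hcard : t.card ≤ 3 := by
        have h1 := hai.card_le_finrank_succ
        have h2 := (vectorSpan ℝ (range ((↑) : t → ℂ))).finrank_le
        rw [Complex.finrank_real_complex] at h2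
        rw [Fintype.card_coe] at h1
        omega
      have htne : t.Nonempty := by
        rw [← Finset.coe_nonempty, ← convexHull_nonempty_iff (𝕜 := ℝ)]
        exact ⟨x, hxt⟩
      obtain ⟨a, b, c, ha, hb, hc, hsub⟩ :
          ∃ a b c, a ∈ A ∧ b ∈ A ∧ c ∈ A ∧ (t : Set ℂ) ⊆ {a, b, c} := by
        have hpos := htne.card_pos
        obtain h | h | h : t.card = 1 ∨ t.card = 2 ∨ t.card = 3 := by omega
        · obtain ⟨a, rfl⟩ := Finset.card_eq_one.1 h
          have ha : a ∈ A := htA (by simp)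
          exact ⟨a, a, a, ha, ha, ha, by simp⟩
        · obtain ⟨a, b, -, rfl⟩ := Finset.card_eq_two.1 h
          have ha : a ∈ A := htA (by simp)
          have hb : b ∈ A := htA (by simp)
          exact ⟨a, b, b, ha, hb, hb, by simp⟩
        · obtain ⟨a, b, c, -, -, -, rfl⟩ := Finset.card_eq_three.1 h
          exact ⟨a, b, c, htA (by simp), htA (by simp), htA (by simp), by simp⟩
      have hx3 := convexHull_mono hsub hxt
      rw [convexHull_insert (by simp), mem_convexJoin] at hx3
      obtain ⟨a', rfl, q, hq, hxq⟩ := hx3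
      rw [convexHull_pair, segment_eq_image'] at hq
      rw [segment_eq_image'] at hxq
      obtain ⟨s, hs, rfl⟩ := hq
      obtain ⟨r, hr, rfl⟩ := hxq
      exact ⟨(a', b, c, s, r), ⟨ha, hb, hc, hs, hr⟩, rfl⟩
    · rintro _ ⟨⟨a, b, c, s, r⟩, ⟨ha, hb, hc, hs, hr⟩, rfl⟩
      have hK := convex_convexHull ℝ A
      have hsub := subset_convexHull ℝ A
      exact hK.add_smul_sub_mem (hsub ha) (hK.add_smul_sub_mem (hsub hb) (hsub hc) hs) hr
  rw [himg]
  refine (hA.prod (hA.prod (hA.prod (isCompact_Icc.prod isCompact_Icc)))).image ?_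
  fun_prop

theorem exists_gap_radialPoint {C A : Set ℂ} (h0 : C ∈ nhds 0) (hA : IsCompact A)
    (hCA : C = convexHull ℝ A) {t : ℝ} (ht : radialPoint C t ∉ A) :
    ∃ a b, a < t ∧ t < b ∧ radialPoint C a ∈ A ∧ radialPoint C b ∈ A ∧
      (∀ s ∈ Ioo a b, radialPoint C s ∉ A) ∧
      radialPoint C t ∈ segment ℝ (radialPoint C a) (radialPoint C b) := by
  have hC : Convex ℝ C := hCA ▸ convex_convexHull ℝ A
  have hb : Bornology.IsBounded C := hCA ▸ isBounded_convexHull.2 hA.isBounded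
  have hCc : IsClosed C := hCA ▸ hA.convexHull_complex.isClosed
  have hACsub : A ⊆ C := hCA ▸ subset_convexHull ℝ A
  have hρ := gauge_circleDir_pos h0 hb
  have hcont := continuous_radialPoint hC h0 hb
  set γ := radialPoint C with hγ
  have h0i : (0 : ℂ) ∈ interior C := mem_interior_iff_mem_nhds.2 h0
  have hγC : γ t ∈ C := by
    rw [← hCc.closure_eq, ← gauge_le_one_iff_mem_closure hC h0]
    exact (gauge_radialPoint h0 hb t).le
  obtain ⟨f, hf⟩ := geometric_hahn_banach_open_point hC.interior isOpen_interior
    (x := γ t) (by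
      rw [← gauge_lt_one_iff_mem_interior hC h0, gauge_radialPoint h0 hb]
      exact lt_irrefl 1)
  have hM : 0 < f (γ t) := by simpa using hf 0 h0i
  have hfC : ∀ z ∈ C, f z ≤ f (γ t) := by
    have : closure (interior C) ⊆ f ⁻¹' Iic (f (γ t)) :=
      closure_minimal (fun z hz => (hf z hz).le) (isClosed_Iic.preimage f.continuous)
    rw [hC.closure_interior_eq_closure_of_nonempty_interior ⟨0, h0i⟩] at this
    exact fun z hz => this (subset_closure hz)
  set D : ℂ →L[ℝ] ℝ := (γ t).re • Complex.imCLM - (γ t).im • Complex.reCLM with hD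
  have hDz : ∀ z, D z = (γ t).re * z.im - (γ t).im * z.re := fun z => by simp [hD]
  have hDp : D (γ t) = 0 := by rw [hDz]; ring
  have hDs : ∀ s, D (γ s) = (gauge C (circleDir t))⁻¹ * (gauge C (circleDir s))⁻¹ *
      Real.sin (s - t) := by
    intro s
    rw [hDz, Real.sin_sub]
    simp only [hγ, radialPoint, circleDir, Complex.real_smul, Complex.add_re, Complex.add_im,
      Complex.re_ofReal_mul, Complex.im_ofReal_mul, Complex.ofReal_re, Complex.ofReal_im,
      Complex.I_re, Complex.I_im]
    ring
  have hinj : ∀ z, f z = f (γ t) → D z = 0 → z = γ t := by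
    intro z hz hDz0
    rw [hDz] at hDz0
    have hp0 : Complex.normSq (γ t) ≠ 0 := by
      rw [Ne, Complex.normSq_eq_zero]
      intro h
      rw [h, map_zero] at hM
      exact hM.ne rfl
    rw [Complex.normSq_apply] at hp0
    have hk : z = (((γ t).re * z.re + (γ t).im * z.im) /
        ((γ t).re * (γ t).re + (γ t).im * (γ t).im)) • γ t := by
      apply Complex.ext <;>
      simp only [Complex.real_smul, Complex.re_ofReal_mul, Complex.im_ofReal_mul] <;>
      rw [div_mul_eq_mul_div, eq_div_iff hp0]
      · linear_combination (γ t).im * (-1) * hDz0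
      · linear_combination (γ t).re * hDz0
    generalize ((γ t).re * z.re + (γ t).im * z.im) /
        ((γ t).re * (γ t).re + (γ t).im * (γ t).im) = k at hk
    rw [hk, map_smul, smul_eq_mul] at hz
    have : k = 1 := by
      have := mul_right_cancel₀ hM.ne' (hz.trans (one_mul _).symm)
      exact this
    rw [hk, this, one_smul]
  have hang : ∀ q ∈ A, f q = f (γ t) → ∃ s ∈ Ico (t - Real.pi) (t - Real.pi + 2 * Real.pi),
      q = γ s := by
    intro q hq hfq
    have hg : gauge C q = 1 := by
      refine (gauge_le_one_of_mem (hACsub hq)).antisymm ?_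
      by_contra! h
      exact (hf q ((gauge_lt_one_iff_mem_interior hC h0).1 h)).ne hfq
    obtain ⟨s, hs, hs'⟩ := (radialPoint_periodic C).exists_mem_Ico (by positivity)
      (Complex.arg q) (t - Real.pi)
    exact ⟨s, hs, by rw [← radialPoint_arg hg, hs']⟩
  have hpA : γ t ∈ convexHull ℝ A := hCA ▸ hγC
  have hfA : ∀ z ∈ A, f z ≤ f (γ t) := fun z hz => hfC z (hACsub hz)
  set H : ℝ → ℝ := fun s => f (circleDir s) - f (γ t) * gauge C (circleDir s) with hHdef
  have hH : SineConcave H := sineConcave_sub_gauge hC h0 f hM.le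
  have hHs : ∀ s, H s = gauge C (circleDir s) * (f (γ s) - f (γ t)) :=
    apply_radialPoint_eq h0 hb f _
  have hHle : ∀ s, H s ≤ 0 := by
    intro s
    rw [hHs]
    refine mul_nonpos_of_nonneg_of_nonpos (hρ s).le (sub_nonpos.2 (hfC _ ?_))
    rw [← hCc.closure_eq, ← gauge_le_one_iff_mem_closure hC h0]
    exact (gauge_radialPoint h0 hb s).le
  have hHt : H t = 0 := by rw [hHs, sub_self, mul_zero]
  have hHeq : ∀ s, H s = 0 → f (γ s) = f (γ t) := by
    intro s hs
    rw [hHs] at hs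
    exact sub_eq_zero.1 ((mul_eq_zero.1 hs).resolve_left (hρ s).ne')
  have hHeq' : ∀ s, f (γ s) = f (γ t) → H s = 0 := by
    intro s hs
    rw [hHs, hs, sub_self, mul_zero]
  have hflat : ∀ s v, s < v → v < s + Real.pi → H s = 0 → H v = 0 → ∀ u ∈ Icc s v, H u = 0 := by
    intro s v hsv hvs hs hv u hu
    have h1 := hH s u v hu.1 hu.2 hvs.le
    rw [hs, hv, mul_zero, mul_zero, add_zero] at h1
    exact (hHle u).antisymm (nonneg_of_mul_nonneg_right h1
      (Real.sin_pos_of_pos_of_lt_pi (by linarith) (by linarith)))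
  have hcoef : ∀ s, 0 < (gauge C (circleDir t))⁻¹ * (gauge C (circleDir s))⁻¹ := fun s =>
    mul_pos (inv_pos.2 (hρ t)) (inv_pos.2 (hρ s))
  obtain ⟨b₀, htb₀, hb₀t, hb₀A, hHb₀⟩ : ∃ b₀, t < b₀ ∧ b₀ < t + Real.pi ∧ γ b₀ ∈ A ∧ H b₀ = 0 := by
    obtain ⟨q, hqA, hfq, hDq⟩ :=
      exists_mem_of_mem_convexHull_of_forall_le hpA ht f D hfA hDp hinj
    obtain ⟨s, hs, rfl⟩ := hang q hqA hfq
    refine ⟨s, ?_, by linarith [hs.2], hqA, hHeq' s hfq⟩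
    by_contra! h
    rw [hDs] at hDq
    have := Real.sin_nonpos_of_nonpos_of_neg_pi_le (by linarith : s - t ≤ 0) (by linarith [hs.1])
    exact hDq.not_ge (mul_nonpos_of_nonneg_of_nonpos (hcoef s).le this)
  obtain ⟨a₀, hat₀, hta₀, ha₀A, hHa₀⟩ : ∃ a₀, a₀ < t ∧ t < a₀ + Real.pi ∧ γ a₀ ∈ A ∧ H a₀ = 0 := by
    obtain ⟨q, hqA, hfq, hDq⟩ :=
      exists_mem_of_mem_convexHull_of_forall_le hpA ht f (-D) hfA (by simp [hDp])
        (fun z hz hz' => hinj z hz (by simpa using hz'))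
    obtain ⟨s, hs, rfl⟩ := hang q hqA hfq
    rw [neg_apply, hDs, neg_pos] at hDq
    refine ⟨s, ?_, ?_, hqA, hHeq' s hfq⟩
    · by_contra! h
      have := Real.sin_nonneg_of_nonneg_of_le_pi (by linarith : 0 ≤ s - t) (by linarith [hs.2])
      exact hDq.not_ge (mul_nonneg (hcoef s).le this)
    · by_contra! h
      have h1 : s - t = -Real.pi := by linarith [hs.1]
      simp [h1] at hDq
  have hBc : IsClosed (γ ⁻¹' A) := hA.isClosed.preimage hcont
  obtain ⟨a, ha, haM⟩ := (isCompact_Icc.inter_right hBc).exists_isGreatest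
    (⟨a₀, ⟨le_rfl, hat₀.le⟩, ha₀A⟩ : (Icc a₀ t ∩ γ ⁻¹' A).Nonempty)
  obtain ⟨b, hb', hbM⟩ := (isCompact_Icc.inter_right hBc).exists_isLeast
    (⟨b₀, ⟨htb₀.le, le_rfl⟩, hb₀A⟩ : (Icc t b₀ ∩ γ ⁻¹' A).Nonempty)
  have hat : a < t := lt_of_le_of_ne ha.1.2 (by rintro rfl; exact ht ha.2)
  have htb : t < b := lt_of_le_of_ne hb'.1.1 (by rintro rfl; exact ht hb'.2)
  refine ⟨a, b, hat, htb, ha.2, hb'.2, ?_, ?_⟩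
  · intro s hs hsA
    rcases le_total s t with h | h
    · exact hs.1.not_ge (haM ⟨⟨ha.1.1.trans hs.1.le, h⟩, hsA⟩)
    · exact hs.2.not_ge (hbM ⟨⟨h, hs.2.le.trans hb'.1.2⟩, hsA⟩)
  · have hfa := hHeq a (hflat a₀ t hat₀ hta₀ hHa₀ hHt a ha.1)
    have hfb := hHeq b (hflat t b₀ htb₀ hb₀t hHt hHb₀ b hb'.1)
    have hdir : ∀ s, circleDir s = gauge C (circleDir s) • γ s := fun s => by
      rw [hγ, radialPoint, smul_inv_smul₀ (hρ s).ne']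
    have hid := sin_smul_circleDir a t b
    rw [hdir a, hdir b, hdir t, smul_smul, smul_smul, smul_smul] at hid
    have hw₁ : 0 < Real.sin (b - t) * gauge C (circleDir a) := mul_pos
      (Real.sin_pos_of_pos_of_lt_pi (by linarith) (by linarith [hb'.1.2])) (hρ a)
    have hw₂ : 0 < Real.sin (t - a) * gauge C (circleDir b) := mul_pos
      (Real.sin_pos_of_pos_of_lt_pi (by linarith) (by linarith [ha.1.1])) (hρ b)
    have hsum := congrArg f hid
    simp only [map_add, map_smul, smul_eq_mul, hfa, hfb, ← add_mul] at hsum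
    rw [mul_right_cancel₀ hM.ne' hsum] at hid
    generalize Real.sin (b - t) * gauge C (circleDir a) = w₁ at hid hw₁
    generalize Real.sin (t - a) * gauge C (circleDir b) = w₂ at hid hw₂
    have hw : 0 < w₁ + w₂ := add_pos hw₁ hw₂
    refine ⟨w₁ / (w₁ + w₂), w₂ / (w₁ + w₂), by positivity, by positivity, by field_simp, ?_⟩
    rw [← inv_smul_smul₀ hw.ne' (γ t), hid, smul_add, smul_smul, smul_smul, div_eq_inv_mul,
      div_eq_inv_mul]

/-- The part of the boundary of the convex hull of `n` planar convex bodies with disjoint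
interiors that lies outside these bodies has at most `2 * n - 2` components. -/
theorem card_components_frontier_convexHull_diff_le {n : ℕ} {C : Set ℂ} {L : Fin n → Set ℂ}
    (hLc : ∀ i, IsCompact (L i)) (hLconv : ∀ i, Convex ℝ (L i))
    (hLi : ∀ i, (interior (L i)).Nonempty)
    (hdisj : ∀ i j, i ≠ j → Disjoint (interior (L i)) (interior (L j)))
    (hC : C = convexHull ℝ (⋃ i, L i)) (hCi : (interior C).Nonempty) :
    Finite (ConnectedComponents ↥(frontier C \ ⋃ i, L i)) ∧
      Nat.card (ConnectedComponents ↥(frontier C \ ⋃ i, L i)) ≤ 2 * n - 2 := by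
  obtain ⟨w, hw⟩ := hCi
  set h : ℂ ≃ₜ ℂ := Homeomorph.addRight (-w) with hh
  have hhmem : ∀ (X : Set ℂ) z, z ∈ h '' X ↔ z + w ∈ X := fun X z => by
    simp [hh]
  have haff : ∀ X : Set ℂ, h '' convexHull ℝ X = convexHull ℝ (h '' X) := fun X =>
    (AffineEquiv.vaddConst ℝ (-w) : ℂ ≃ᵃ[ℝ] ℂ).toAffineMap.image_convexHull X
  have hconv : ∀ X : Set ℂ, Convex ℝ X → Convex ℝ (h '' X) := fun X hX => by
    rw [← hX.convexHull_eq, haff]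
    exact convex_convexHull ℝ _
  have hLC : ∀ i, L i ⊆ C := fun i =>
    hC ▸ (subset_iUnion L i).trans (subset_convexHull ℝ _)
  have hA : IsCompact (⋃ i, L i) := isCompact_iUnion hLc
  have hC0 : h '' C = convexHull ℝ (h '' ⋃ i, L i) := by rw [hC, haff]
  have h0 : h '' C ∈ nhds 0 := by
    rw [← mem_interior_iff_mem_nhds, ← h.image_interior, hhmem, zero_add]
    exact hw
  have hCconv : Convex ℝ (h '' C) := hC0 ▸ convex_convexHull ℝ _
  have hb : Bornology.IsBounded (h '' C) :=
    hC0 ▸ isBounded_convexHull.2 (hA.image h.continuous).isBounded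
  have hmem : ∀ (X : Set ℂ) t, radialPoint (h '' C) t + w ∈ X ↔ radialPoint (h '' C) t ∈ h '' X :=
    fun X t => (hhmem X _).symm
  refine card_components_le_of_noncrossing (fun t => radialPoint (h '' C) t + w)
    ((continuous_radialPoint hCconv h0 hb).add_const w)
    (fun t => by simp only [radialPoint_periodic _ t]) L ?_ ?_ _ ?_
  · intro t ht
    obtain ⟨a, b, hat, htb, ha, hb', hab, hseg⟩ :=
      exists_gap_radialPoint h0 (hA.image h.continuous) hC0 (t := t) (by
        rw [← hmem]
        simpa using ht)
    rw [← hmem, mem_iUnion] at ha hb'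
    refine ⟨a, b, hat, htb, ha, hb', fun s hs i hi => hab s hs ?_, fun i hai hbi => ht i ?_⟩
    · rw [← hmem]
      exact mem_iUnion_of_mem i hi
    · rw [hmem] at hai hbi ⊢
      exact (hconv _ (hLconv i)).segment_subset hai hbi hseg
  · intro i j hij t₁ t₂ t₃ t₄ h12 h23 h34 h41 h1 h2 h3 h4
    rw [hmem] at h1 h2 h3 h4
    refine radialPoint_noncrossing hCconv h0 hb (hconv _ (hLconv i)) (hconv _ (hLconv j))
      (image_mono (hLC i)) (image_mono (hLC j)) ?_ ?_ ?_ h12 h23 h34 h41 h1 h2 h3 h4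
    · rw [← h.image_interior]
      exact (hLi i).image h
    · rw [← h.image_interior]
      exact (hLi j).image h
    · rw [← h.image_interior, ← h.image_interior, disjoint_image_iff h.injective]
      exact hdisj i j hij
  · congr 1
    ext z
    have h1 : z ∈ frontier C ↔ z + -w ∈ frontier (h '' C) := by
      rw [← h.image_frontier, hhmem, neg_add_cancel_right]
    rw [h1, ← range_radialPoint hCconv h0 hb]
    simp only [mem_range, eq_add_neg_iff_add_eq]

/-- A compact attractor of strict contractions is contained in the closure of every nonempty
open-set-condition set. -/
theorem attractor_subset_closure {ι X : Type*} [PseudoMetricSpace X] {φ : ι → X → X}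
    {q : ι → ℝ} (hq : ∀ i, 0 ≤ q i ∧ q i < 1)
    (hφ : ∀ i x y, dist (φ i x) (φ i y) = q i * dist x y) {K O : Set X} (hK : IsCompact K)
    (hKinv : K ⊆ ⋃ i, φ i '' K) (hO : O.Nonempty) (hφO : ∀ i, φ i '' O ⊆ O) :
    K ⊆ closure O := by
  intro x hx
  obtain ⟨k, hk, hmax⟩ := hK.exists_isMaxOn ⟨x, hx⟩
    (Metric.continuous_infDist_pt O).continuousOn
  have hd : Metric.infDist k O ≤ 0 := by
    obtain ⟨i, k', hk', rfl⟩ := mem_iUnion.1 (hKinv hk)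
    have h1 : Metric.infDist (φ i k') O ≤ q i * Metric.infDist k' O := by
      refine le_of_forall_pos_le_add fun ε hε => ?_
      obtain ⟨y, hy, hky⟩ := (Metric.infDist_lt_iff hO (x := k')
        (r := Metric.infDist k' O + ε)).1 (by linarith)
      have h2 := Metric.infDist_le_dist_of_mem (x := φ i k') (hφO i (mem_image_of_mem _ hy))
      rw [hφ] at h2
      nlinarith [hq i, mul_le_mul_of_nonneg_left hky.le (hq i).1]
    have h3 : Metric.infDist k' O ≤ Metric.infDist (φ i k') O := hmax hk'
    nlinarith [hq i, mul_le_mul_of_nonneg_left h3 (hq i).1]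
  rw [Metric.mem_closure_iff_infDist_zero hO]
  exact ((hmax hx : Metric.infDist x O ≤ _).trans hd).antisymm Metric.infDist_nonneg

/-- Proposition 5: under the open convex set condition (with `K̃` having nonempty interior),
the set `frontier K̃ \ ⋃ i (φ i '' K̃ ∩ frontier K̃)` has at most `2n - 2` connected
components (the open sides of order 1). -/
theorem sides_of_order_one_finite
    (n : ℕ) (hn : 2 ≤ n)
    (qs αs : Fin n → ℝ) (zs : Fin n → ℂ)
    (hqs : ∀ i, 0 < qs i ∧ qs i < 1)
    (φ : Fin n → ℂ → ℂ)
    (hφ : ∀ i z, φ i z = (qs i : ℂ) * Complex.exp (Complex.I * (αs i : ℂ)) * (z - zs i) + zs i)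
    (K : Set ℂ) (hKne : K.Nonempty) (hKc : IsCompact K)
    (hKinv : K = ⋃ i, φ i '' K)
    (hOCSC : ∃ O : Set ℂ, O.Nonempty ∧ IsOpen O ∧ Convex ℝ O ∧
      (⋃ i, φ i '' O) ⊆ O ∧ ∀ i j, i ≠ j → φ i '' O ∩ φ j '' O = ∅)
    (hint : (interior (convexHull ℝ K)).Nonempty)
    (S : Set ℂ)
    (hS : S = frontier (convexHull ℝ K) \
      ⋃ i, (φ i '' (convexHull ℝ K) ∩ frontier (convexHull ℝ K))) :
    Finite (ConnectedComponents S) ∧ Nat.card (ConnectedComponents S) ≤ 2 * n - 2 := by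
  obtain ⟨O, hOne, hOo, hOc, hOφ, hOd⟩ := hOCSC
  have hdist : ∀ i x y, dist (φ i x) (φ i y) = qs i * dist x y := by
    intro i x y
    rw [hφ, hφ, dist_add_right, dist_eq_norm, dist_eq_norm, ← mul_sub, sub_sub_sub_cancel_right,
      norm_mul, norm_mul, mul_comm Complex.I, Complex.norm_exp_ofReal_mul_I, Complex.norm_real,
      Real.norm_of_nonneg (hqs i).1.le, mul_one]
  have hcoef : ∀ i, (qs i : ℂ) * Complex.exp (Complex.I * (αs i : ℂ)) ≠ 0 := fun i =>
    mul_ne_zero (Complex.ofReal_ne_zero.2 (hqs i).1.ne') (Complex.exp_ne_zero _)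
  have hhomeo : ∀ i, ∃ h : ℂ ≃ₜ ℂ, ⇑h = φ i := fun i =>
    ⟨((Homeomorph.subRight (zs i)).trans (Homeomorph.mulLeft₀ _ (hcoef i))).trans
      (Homeomorph.addRight (zs i)), by ext z; simp [hφ]⟩
  have haff : ∀ i (X : Set ℂ), φ i '' convexHull ℝ X = convexHull ℝ (φ i '' X) := by
    intro i X
    have h : φ i = ((LinearMap.mulLeft ℝ ((qs i : ℂ) * Complex.exp (Complex.I * (αs i : ℂ)))
        ).toAffineMap + AffineMap.const ℝ ℂ (zs i -
          (qs i : ℂ) * Complex.exp (Complex.I * (αs i : ℂ)) * zs i) : ℂ →ᵃ[ℝ] ℂ) := by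
      ext z
      simp only [hφ, AffineMap.coe_add, Pi.add_apply, LinearMap.coe_toAffineMap,
        LinearMap.mulLeft_apply, AffineMap.coe_const, Function.const_apply]
      ring
    rw [h]
    exact AffineMap.image_convexHull _ X
  have hKO : interior (convexHull ℝ K) ⊆ O := by
    have h1 : convexHull ℝ K ⊆ closure O := convexHull_min
      (attractor_subset_closure (fun i => ⟨(hqs i).1.le, (hqs i).2⟩) hdist hKc hKinv.subset hOne
        fun i => (subset_iUnion (fun i => φ i '' O) i).trans hOφ) hOc.closure
    have h2 := interior_mono h1
    rwa [hOc.interior_closure_eq_interior_of_nonempty_interior (hOo.interior_eq.symm ▸ hOne),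
      hOo.interior_eq] at h2
  have hinter : ∀ i, interior (φ i '' convexHull ℝ K) = φ i '' interior (convexHull ℝ K) := by
    intro i
    obtain ⟨h, hh⟩ := hhomeo i
    rw [← hh, h.image_interior]
  have hSeq : S = frontier (convexHull ℝ K) \ ⋃ i, φ i '' convexHull ℝ K := by
    rw [hS, ← iUnion_inter, sdiff_inter_self_eq_sdiff]
  rw [hSeq]
  have hsub : ∀ i, φ i '' convexHull ℝ K ⊆ convexHull ℝ K := fun i => by
    rw [haff]
    refine convexHull_mono ?_
    conv_rhs => rw [hKinv]
    exact subset_iUnion (fun i => φ i '' K) i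
  refine card_components_frontier_convexHull_diff_le (fun i => ?_) (fun i => ?_) (fun i => ?_)
    (fun i j hij => ?_) ?_ hint
  · obtain ⟨h, hh⟩ := hhomeo i
    exact hKc.convexHull_complex.image (hh ▸ h.continuous)
  · rw [haff]
    exact convex_convexHull ℝ _
  · rw [hinter]
    exact hint.image _
  · rw [hinter, hinter]
    exact (disjoint_iff_inter_eq_empty.2 (hOd i j hij)).mono (image_mono hKO) (image_mono hKO)
  · apply Subset.antisymm
    · refine convexHull_mono ?_
      conv_lhs => rw [hKinv]
      exact iUnion_mono fun i => image_mono (subset_convexHull ℝ K)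
    · exact convexHull_min (iUnion_subset hsub) (convex_convexHull ℝ K)
end
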